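/- arXiv:2409.04024 — 4 statements merged into one kernel-verified Lean document; each statement's English description precedes it below -/
import Mathlib

section
/- Let μ1, μ2 ∈ ℝ, μ3 ≥ 0 and b > 0. Then every periodic solution of system (I) is constant; that is, if γ : ℝ → ℝ × ℝ is a solution of (I) and there exists T > 0 with γ(t + T) = γ(t) for all t, then γ is a constant function. (Hence system (I) has no limit cycles when μ3 ≥ 0.) -/
/-- A solution of system (I): x' = y, y' = −(μ1 x + μ2 x³ + x⁵) − (μ3 + b x²) y. -/
def IsSolI (μ1 μ2 μ3 b : ℝ) (γ : ℝ → ℝ × ℝ) : Prop :=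
  ∀ t : ℝ, HasDerivAt γ
    ((γ t).2,
      -(μ1 * (γ t).1 + μ2 * (γ t).1 ^ 3 + (γ t).1 ^ 5) - (μ3 + b * (γ t).1 ^ 2) * (γ t).2) t

/-- An antitone periodic real function is constant. -/
theorem Antitone.eq_of_periodic {f : ℝ → ℝ} {T : ℝ} (hf : Antitone f)
    (hper : Function.Periodic f T) (hT : 0 < T) (t s : ℝ) : f t = f s := by
  have key : ∀ t s : ℝ, f s ≤ f t := by
    intro t s
    obtain ⟨n, hn⟩ := exists_nat_ge ((t - s) / T)
    rw [div_le_iff₀ hT] at hn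
    calc f s = f (s + n * T) := (hper.nat_mul n s).symm
      _ ≤ f t := hf (by linarith)
  exact le_antisymm (key s t) (key t s)

/-- if μ3 ≥ 0 and b > 0, every periodic solution of system (I) is constant. -/
theorem stmt1 (μ1 μ2 μ3 b : ℝ) (hμ3 : 0 ≤ μ3) (hb : 0 < b)
    (γ : ℝ → ℝ × ℝ) (hsol : IsSolI μ1 μ2 μ3 b γ)
    (T : ℝ) (hT : 0 < T) (hper : ∀ t : ℝ, γ (t + T) = γ t) :
    ∀ t s : ℝ, γ t = γ s := by
  have hx : ∀ t, HasDerivAt (fun t => (γ t).1) (γ t).2 t := fun t => (hsol t).fst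
  have hy : ∀ t, HasDerivAt (fun t => (γ t).2)
      (-(μ1 * (γ t).1 + μ2 * (γ t).1 ^ 3 + (γ t).1 ^ 5)
        - (μ3 + b * (γ t).1 ^ 2) * (γ t).2) t := fun t => (hsol t).snd
  set energy : ℝ → ℝ := fun t =>
    (γ t).2 ^ 2 / 2 + μ1 * (γ t).1 ^ 2 / 2 + μ2 * (γ t).1 ^ 4 / 4 + (γ t).1 ^ 6 / 6
    with henergy
  have hE : ∀ t, HasDerivAt energy (-((μ3 + b * (γ t).1 ^ 2) * (γ t).2 ^ 2)) t := by
    intro t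
    have h := (((((hy t).pow 2).div_const 2).add
      ((((hx t).pow 2).const_mul μ1).div_const 2)).add
      ((((hx t).pow 4).const_mul μ2).div_const 4)).add (((hx t).pow 6).div_const 6)
    refine h.congr_deriv ?_
    push_cast
    ring
  have hanti : Antitone energy :=
    antitone_of_hasDerivAt_nonpos hE fun t => neg_nonpos.mpr (by positivity)
  have hEper : Function.Periodic energy T := fun t => by simp only [henergy, hper]
  have hEconst : energy = fun _ => energy 0 :=
    funext fun t => hanti.eq_of_periodic hEper hT t 0
  have hxy : ∀ t, (γ t).1 * (γ t).2 = 0 := by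
    intro t
    have h := hE t
    rw [hEconst] at h
    have h0 := h.unique (hasDerivAt_const t (energy 0))
    have h1 : 0 ≤ μ3 * (γ t).2 ^ 2 := by positivity
    have h2 : 0 ≤ b * ((γ t).1 * (γ t).2) ^ 2 := by positivity
    have h3 : b * ((γ t).1 * (γ t).2) ^ 2 = 0 := by linarith
    simpa [hb.ne'] using h3
  have hsq : ∀ t s, (γ t).1 ^ 2 = (γ s).1 ^ 2 := by
    have hd : ∀ t, HasDerivAt (fun t => (γ t).1 ^ 2) 0 t := fun t =>
      ((hx t).pow 2).congr_deriv (by push_cast; linear_combination 2 * hxy t)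
    exact is_const_of_deriv_eq_zero (fun t => (hd t).differentiableAt) fun t => (hd t).deriv
  have hy0 : ∀ t, (γ t).2 = 0 := by
    intro t
    rcases mul_eq_zero.mp (hxy t) with h | h
    · have hx0 : (fun s => (γ s).1) = fun _ => 0 := by
        funext s
        simpa [h] using hsq s t
      have hd := hx t
      rw [hx0] at hd
      exact hd.unique (hasDerivAt_const t 0)
    · exact h
  intro t s
  refine Prod.ext ?_ ((hy0 t).trans (hy0 s).symm)
  exact is_const_of_deriv_eq_zero (fun t => (hx t).differentiableAt)
    (fun t => (hx t).deriv.trans (hy0 t)) t s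
end

section
/- Suppose (μ2² − 4·μ1 < 0 and μ2 < 0) or (μ1 ≥ 0 and μ2 ≥ 0), and suppose μ3 < 0 and b > 0. Then system (I) has a nonconstant periodic solution, and any two nonconstant periodic solutions of (I) have the same image (range) in ℝ × ℝ. (That is, system (I) has a unique limit cycle.) -/
/-- A nonconstant periodic solution of system (I). -/
def IsNonconstPeriodicSolI (μ1 μ2 μ3 b : ℝ) (γ : ℝ → ℝ × ℝ) : Prop :=
  IsSolI μ1 μ2 μ3 b γ ∧ (∃ T : ℝ, 0 < T ∧ ∀ t : ℝ, γ (t + T) = γ t) ∧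
    ¬ (∀ t s : ℝ, γ t = γ s)

section LienardTheorem

open Set Filter Topology Metric NNReal

section Calculus

/-- If `f a ≤ c` and `f` is nonincreasing wherever it exceeds `c`, then `f ≤ c`. -/
lemma le_of_deriv_nonpos_of_lt {f f' : ℝ → ℝ} {a b c : ℝ}
    (hf : ∀ t ∈ Icc a b, HasDerivAt f (f' t) t) (ha : f a ≤ c)
    (h : ∀ t ∈ Icc a b, c < f t → f' t ≤ 0) : ∀ t ∈ Icc a b, f t ≤ c := by
  intro t ht
  refine le_of_forall_pos_le_add fun ε hε => ?_
  have h1 : 0 < 1 + t - a := by linarith [ht.1]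
  set δ := ε / (1 + t - a) with hδ
  have hδ0 : 0 < δ := div_pos hε h1
  have key := image_le_of_deriv_right_lt_deriv_boundary (f := f) (f' := f') (a := a) (b := b)
    (B := fun x => c + δ * (1 + x - a)) (B' := fun _ => δ)
    (fun x hx => (hf x hx).continuousAt.continuousWithinAt)
    (fun x hx => (hf x ⟨hx.1, hx.2.le⟩).hasDerivWithinAt) (by simp; linarith)
    (fun x => by
      have : HasDerivAt (fun x : ℝ => c + δ * (1 + x - a)) (δ * 1) x :=
        ((((hasDerivAt_id x).const_add 1).sub_const a).const_mul δ).const_add c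
      simpa using this)
    (fun x hx hfx => by
      have hpos : 0 < δ * (1 + x - a) := mul_pos hδ0 (by linarith [hx.1])
      have := h x ⟨hx.1, hx.2.le⟩ (by rw [hfx]; linarith)
      linarith) ht
  have : δ * (1 + t - a) = ε := by rw [hδ]; field_simp
  simpa [this] using key

/-- A function which is decreasing at each of its zeros stays negative once it is nonpositive. -/
lemma neg_of_deriv_neg_of_zero {f f' : ℝ → ℝ} {a b : ℝ}
    (hf : ∀ t ∈ Icc a b, HasDerivAt f (f' t) t) (ha : f a ≤ 0)
    (h : ∀ t ∈ Icc a b, f t = 0 → f' t < 0) : ∀ t ∈ Ioc a b, f t < 0 := by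
  intro t ht
  have hle : ∀ s ∈ Icc a b, f s ≤ 0 := by
    refine image_le_of_deriv_right_lt_deriv_boundary (f' := f') (B := fun _ => 0)
      (B' := fun _ => 0) (fun x hx => (hf x hx).continuousAt.continuousWithinAt)
      (fun x hx => (hf x ⟨hx.1, hx.2.le⟩).hasDerivWithinAt) ha (fun x => hasDerivAt_const x _) ?_
    exact fun x hx hx0 => h x ⟨hx.1, hx.2.le⟩ hx0
  refine lt_of_le_of_ne (hle t ⟨ht.1.le, ht.2⟩) fun h0 => ?_
  have htI : t ∈ Icc a b := ⟨ht.1.le, ht.2⟩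
  have hev : ∀ᶠ z in 𝓝[<] t, slope f t z < 0 :=
    ((hasDerivAt_iff_tendsto_slope.1 (hf t htI)).mono_left
      (nhdsWithin_mono _ (fun z hz => ne_of_lt hz))).eventually_lt_const (h t htI h0)
  obtain ⟨z, hz, hzt⟩ := (hev.and (Ioo_mem_nhdsLT ht.1)).exists
  rw [slope_def_field, h0, sub_zero] at hz
  have := hle z ⟨hzt.1.le, hzt.2.le.trans ht.2⟩
  have h2 : 0 ≤ f z / (z - t) := div_nonneg_of_nonpos this (by linarith [hzt.2])
  linarith

/-- A curve `(p, q)` with `p` strictly increasing is the graph of a function of `p`. -/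
lemma exists_reparametrization {p q p' q' : ℝ → ℝ} {s t : ℝ} (hst : s ≤ t)
    (hp : ∀ r ∈ Icc s t, HasDerivAt p (p' r) r) (hq : ∀ r ∈ Icc s t, HasDerivAt q (q' r) r)
    (hpos : ∀ r ∈ Ioo s t, 0 < p' r) :
    ∃ Q : ℝ → ℝ, (∀ r ∈ Icc s t, Q (p r) = q r) ∧ ContinuousOn Q (Icc (p s) (p t)) ∧
      ∀ r ∈ Ioo s t, HasDerivAt Q (q' r / p' r) (p r) := by
  have hpc : ContinuousOn p (Icc s t) := fun r hr => (hp r hr).continuousAt.continuousWithinAt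
  have hqc : ContinuousOn q (Icc s t) := fun r hr => (hq r hr).continuousAt.continuousWithinAt
  have hmono : StrictMonoOn p (Icc s t) := by
    refine strictMonoOn_of_hasDerivWithinAt_pos (convex_Icc s t) hpc (f' := p') ?_ ?_
    · intro x hx
      rw [interior_Icc] at hx
      exact (hp x ⟨hx.1.le, hx.2.le⟩).hasDerivWithinAt
    · intro x hx
      rw [interior_Icc] at hx
      exact hpos x hx
  have hs : s ∈ Icc s t := left_mem_Icc.2 hst
  have ht : t ∈ Icc s t := right_mem_Icc.2 hst
  have hmaps : MapsTo p (Icc s t) (Icc (p s) (p t)) := fun r hr =>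
    ⟨hmono.monotoneOn hs hr hr.1, hmono.monotoneOn hr ht hr.2⟩
  have hsurj : SurjOn p (Icc s t) (Icc (p s) (p t)) := intermediate_value_Icc hst hpc
  set σ := Function.invFunOn p (Icc s t) with hσ
  have hσl : ∀ r ∈ Icc s t, σ (p r) = r := fun r hr => hmono.injOn.leftInvOn_invFunOn hr
  have hσr : ∀ y ∈ Icc (p s) (p t), p (σ y) = y := fun y hy =>
    hsurj.rightInvOn_invFunOn hy
  have hquot : IsQuotientMap (MapsTo.restrict p (Icc s t) (Icc (p s) (p t)) hmaps) :=
    IsQuotientMap.of_surjective_continuous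
      (by
        rintro ⟨y, hy⟩
        obtain ⟨r, hr, h⟩ := hsurj hy
        exact ⟨⟨r, hr⟩, Subtype.ext h⟩)
      (hpc.mapsToRestrict hmaps)
  have hσc : ContinuousOn σ (Icc (p s) (p t)) := by
    rw [continuousOn_iff_continuous_domRestrict, hquot.continuous_iff]
    have : (Icc (p s) (p t)).domRestrict σ ∘ MapsTo.restrict p (Icc s t) (Icc (p s) (p t)) hmaps
        = Subtype.val := by
      funext r
      exact hσl r r.2
    rw [this]
    exact continuous_subtype_val
  have hσm : MapsTo σ (Icc (p s) (p t)) (Icc s t) := fun y hy => by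
    obtain ⟨r, hr, rfl⟩ := hsurj hy
    rw [hσl r hr]
    exact hr
  refine ⟨q ∘ σ, fun r hr => by simp [hσl r hr], hqc.comp hσc hσm, fun r hr => ?_⟩
  have hr' : r ∈ Icc s t := ⟨hr.1.le, hr.2.le⟩
  have hnhds : Icc (p s) (p t) ∈ 𝓝 (p r) :=
    Icc_mem_nhds (hmono hs hr' hr.1) (hmono hr' ht hr.2)
  have hσd : HasDerivAt σ (p' r)⁻¹ (p r) := by
    refine HasDerivAt.of_local_left_inverse (f := p) (hσc.continuousAt hnhds) ?_ (hpos r hr).ne' ?_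
    · rw [hσl r hr']
      exact hp r hr'
    · filter_upwards [hnhds] with y hy using hσr y hy
  have hqd : HasDerivAt q (q' r) (σ (p r)) := by
    rw [hσl r hr']
    exact hq r hr'
  simpa [div_eq_mul_inv] using hqd.comp (p r) hσd

end Calculus

section ODE

variable {E : Type*} [NormedAddCommGroup E] [NormedSpace ℝ E]

/-- Two solutions of an autonomous `C¹` differential equation on a compact interval which agree at
one point of the interval agree on the whole interval. -/
lemma eqOn_of_hasDerivAt_of_contDiff [FiniteDimensional ℝ E] {v : E → E} (hv : ContDiff ℝ 1 v)
    {f g : ℝ → E} {a b t₀ : ℝ} (hf : ∀ t ∈ Icc a b, HasDerivAt f (v (f t)) t)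
    (hg : ∀ t ∈ Icc a b, HasDerivAt g (v (g t)) t) (ht₀ : t₀ ∈ Icc a b) (h : f t₀ = g t₀) :
    EqOn f g (Icc a b) := by
  have hfc : ContinuousOn f (Icc a b) := fun t ht => (hf t ht).continuousAt.continuousWithinAt
  have hgc : ContinuousOn g (Icc a b) := fun t ht => (hg t ht).continuousAt.continuousWithinAt
  obtain ⟨R, hR⟩ := ((isCompact_Icc.image_of_continuousOn hfc).union
    (isCompact_Icc.image_of_continuousOn hgc)).isBounded.subset_closedBall 0
  obtain ⟨K, hK⟩ := hv.contDiffOn.exists_lipschitzOnWith one_ne_zero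
    (convex_closedBall (0 : E) R) (isCompact_closedBall 0 R)
  have hfs : ∀ t ∈ Icc a b, f t ∈ closedBall (0 : E) R := fun t ht =>
    hR (Or.inl (mem_image_of_mem f ht))
  have hgs : ∀ t ∈ Icc a b, g t ∈ closedBall (0 : E) R := fun t ht =>
    hR (Or.inr (mem_image_of_mem g ht))
  have hl : Icc a t₀ ⊆ Icc a b := Icc_subset_Icc_right ht₀.2
  have hr : Icc t₀ b ⊆ Icc a b := Icc_subset_Icc_left ht₀.1
  rw [← Icc_union_Icc_eq_Icc ht₀.1 ht₀.2]
  refine EqOn.union ?_ ?_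
  · exact ODE_solution_unique_of_mem_Icc_left (v := fun _ => v) (s := fun _ => closedBall 0 R)
      (fun t _ => hK) (hfc.mono hl)
      (fun t ht => (hf t (hl (Ioc_subset_Icc_self ht))).hasDerivWithinAt)
      (fun t ht => hfs t (hl (Ioc_subset_Icc_self ht))) (hgc.mono hl)
      (fun t ht => (hg t (hl (Ioc_subset_Icc_self ht))).hasDerivWithinAt)
      (fun t ht => hgs t (hl (Ioc_subset_Icc_self ht))) h
  · exact ODE_solution_unique_of_mem_Icc_right (v := fun _ => v) (s := fun _ => closedBall 0 R)
      (fun t _ => hK) (hfc.mono hr)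
      (fun t ht => (hf t (hr (Ico_subset_Icc_self ht))).hasDerivWithinAt)
      (fun t ht => hfs t (hr (Ico_subset_Icc_self ht))) (hgc.mono hr)
      (fun t ht => (hg t (hr (Ico_subset_Icc_self ht))).hasDerivWithinAt)
      (fun t ht => hgs t (hr (Ico_subset_Icc_self ht))) h

lemma eq_of_hasDerivAt_of_contDiff [FiniteDimensional ℝ E] {v : E → E} (hv : ContDiff ℝ 1 v)
    {f g : ℝ → E} {t₀ : ℝ} (hf : ∀ t, HasDerivAt f (v (f t)) t)
    (hg : ∀ t, HasDerivAt g (v (g t)) t) (h : f t₀ = g t₀) : f = g := by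
  funext t
  exact eqOn_of_hasDerivAt_of_contDiff hv (a := min t t₀) (b := max t t₀) (fun s _ => hf s)
    (fun s _ => hg s) ⟨min_le_right _ _, le_max_right _ _⟩ h ⟨min_le_left _ _, le_max_left _ _⟩

/-- A compactly supported `C¹` vector field has global integral curves. -/
lemma exists_forall_hasDerivAt_of_hasCompactSupport [FiniteDimensional ℝ E] {v : E → E}
    (hv : ContDiff ℝ 1 v) (hc : HasCompactSupport v) (x₀ : E) :
    ∃ γ : ℝ → E, γ 0 = x₀ ∧ ∀ t, HasDerivAt γ (v (γ t)) t := by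
  have : CompleteSpace E := FiniteDimensional.complete ℝ E
  obtain ⟨K, hK⟩ := hv.lipschitzWith_of_hasCompactSupport hc one_ne_zero
  obtain ⟨C, hC⟩ := hc.exists_bound_of_continuous hv.continuous
  have hex : ∀ n : ℝ, ∃ γ : ℝ → E, γ 0 = x₀ ∧ ∀ t ∈ Ioo (-|n|) |n|, HasDerivAt γ (v (γ t)) t := by
    intro n
    have hn := abs_nonneg n
    have hpl : IsPicardLindelof (fun _ => v) (tmin := -|n|) (tmax := |n|)
        ⟨0, by simp, hn⟩ x₀ (C.toNNReal * ‖n‖₊) 0 C.toNNReal K :=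
      IsPicardLindelof.of_time_independent
        (fun x _ => (hC x).trans (Real.le_coe_toNNReal C)) (hK.lipschitzOnWith) (by simp)
    obtain ⟨γ, h0, hγ⟩ := hpl.exists_eq_forall_mem_Icc_hasDerivWithinAt₀
    exact ⟨γ, h0, fun t ht => (hγ t ⟨ht.1.le, ht.2.le⟩).hasDerivAt (Icc_mem_nhds ht.1 ht.2)⟩
  choose γ h0 hγ using hex
  have hcons : ∀ m n : ℝ, 0 < m → m ≤ n → ∀ t ∈ Ioo (-m) m, γ m t = γ n t := by
    intro m n hm hmn t ht
    refine ODE_solution_unique_of_mem_Ioo (v := fun _ => v) (s := fun _ => univ) (K := K)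
      (a := -m) (b := m) (t₀ := 0) (fun _ _ => hK.lipschitzOnWith) ⟨by linarith, hm⟩
      (fun s hs => ⟨hγ m s ?_, mem_univ _⟩) (fun s hs => ⟨hγ n s ?_, mem_univ _⟩)
      (by rw [h0, h0]) ht
    · rwa [abs_of_pos hm]
    · rw [abs_of_pos (hm.trans_le hmn)]
      exact ⟨by linarith [hs.1], by linarith [hs.2]⟩
  refine ⟨fun t => γ (|t| + 1) t, h0 _, fun t => ?_⟩
  have hpos : 0 < |t| + 2 := by positivity
  have hmem : ∀ s, |s| < |t| + 1 → γ (|s| + 1) s = γ (|t| + 2) s := fun s hs =>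
    hcons _ _ (by positivity) (by linarith) s (abs_lt.1 (by linarith))
  have hev : (fun s => γ (|s| + 1) s) =ᶠ[𝓝 t] γ (|t| + 2) := by
    filter_upwards [(continuous_abs.tendsto t).eventually_lt_const (lt_add_one |t|)] with s hs
    exact hmem s hs
  have hd := hγ (|t| + 2) t (by rw [abs_of_pos hpos]; exact abs_lt.1 (by linarith))
  rw [← hmem t (by linarith)] at hd
  exact hd.congr_of_eventuallyEq hev

end ODE

section Lienard

/-- The vector field `(x, u) ↦ (u - F x, -g x)` of a Liénard system in the Liénard plane. -/
def lienardField (F g : ℝ → ℝ) (p : ℝ × ℝ) : ℝ × ℝ := (p.2 - F p.1, -g p.1)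

/-- The hypotheses of Liénard's theorem on the damping primitive `F` and the restoring force `g`,
whose potential is `G`. -/
structure IsLienard (F g G : ℝ → ℝ) (a : ℝ) : Prop where
  contDiff_F : ContDiff ℝ 1 F
  contDiff_g : ContDiff ℝ 1 g
  hasDerivAt_G : ∀ x, HasDerivAt G (g x) x
  G_zero : G 0 = 0
  F_neg : ∀ x, F (-x) = -F x
  g_neg : ∀ x, g (-x) = -g x
  g_pos : ∀ x, 0 < x → 0 < g x
  a_pos : 0 < a
  F_lt_zero : ∀ x ∈ Ioo 0 a, F x < 0
  F_a : F a = 0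
  F_strictMonoOn : StrictMonoOn F (Ici a)

/-- `γ` restricted to `[0, T]` is an orbit arc of the Liénard system from `(0, p)` to `(0, -q)`
through the half plane `0 < x`. -/
structure IsLienardArc (F g : ℝ → ℝ) (γ : ℝ → ℝ × ℝ) (T p q : ℝ) : Prop where
  T_pos : 0 < T
  p_pos : 0 < p
  q_pos : 0 < q
  deriv : ∀ t ∈ Icc 0 T, HasDerivAt γ (lienardField F g (γ t)) t
  start : γ 0 = (0, p)
  finish : γ T = (0, -q)
  pos : ∀ t ∈ Ioo 0 T, 0 < (γ t).1

variable {F g G : ℝ → ℝ} {a : ℝ}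

lemma HasDerivAt.lienard_fst {γ : ℝ → ℝ × ℝ} {t : ℝ}
    (h : HasDerivAt γ (lienardField F g (γ t)) t) :
    HasDerivAt (fun s => (γ s).1) ((γ t).2 - F (γ t).1) t :=
  (hasFDerivAt_fst (𝕜 := ℝ) (p := γ t)).comp_hasDerivAt t h

lemma HasDerivAt.lienard_snd {γ : ℝ → ℝ × ℝ} {t : ℝ}
    (h : HasDerivAt γ (lienardField F g (γ t)) t) :
    HasDerivAt (fun s => (γ s).2) (-g (γ t).1) t :=
  (hasFDerivAt_snd (𝕜 := ℝ) (p := γ t)).comp_hasDerivAt t h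

namespace IsLienard

lemma F_zero (h : IsLienard F g G a) : F 0 = 0 := by
  have := h.F_neg 0
  rw [neg_zero] at this
  linarith

lemma g_zero (h : IsLienard F g G a) : g 0 = 0 := by
  have := h.g_neg 0
  rw [neg_zero] at this
  linarith

lemma g_nonneg (h : IsLienard F g G a) {x : ℝ} (hx : 0 ≤ x) : 0 ≤ g x := by
  rcases hx.eq_or_lt with rfl | hx
  · exact h.g_zero.ge
  · exact (h.g_pos x hx).le

lemma F_nonpos (h : IsLienard F g G a) {x : ℝ} (hx : x ∈ Icc 0 a) : F x ≤ 0 := by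
  rcases hx.1.eq_or_lt with rfl | h0
  · exact h.F_zero.le
  rcases hx.2.eq_or_lt with rfl | ha
  · exact h.F_a.le
  exact (h.F_lt_zero x ⟨h0, ha⟩).le

lemma F_nonneg (h : IsLienard F g G a) {x : ℝ} (hx : a ≤ x) : 0 ≤ F x := by
  rw [← h.F_a]
  exact h.F_strictMonoOn.monotoneOn self_mem_Ici hx hx

lemma continuous_G (h : IsLienard F g G a) : Continuous G :=
  continuous_iff_continuousAt.2 fun x => (h.hasDerivAt_G x).continuousAt

lemma G_strictMonoOn (h : IsLienard F g G a) : StrictMonoOn G (Ici 0) := by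
  refine strictMonoOn_of_hasDerivWithinAt_pos (convex_Ici 0) h.continuous_G.continuousOn
    (f' := g) (fun x _ => (h.hasDerivAt_G x).hasDerivWithinAt) fun x hx => ?_
  rw [interior_Ici] at hx
  exact h.g_pos x hx

lemma contDiff_field (h : IsLienard F g G a) : ContDiff ℝ 1 (lienardField F g) :=
  (contDiff_snd.sub (h.contDiff_F.comp contDiff_fst)).prodMk
    (h.contDiff_g.comp contDiff_fst).neg

lemma field_neg (h : IsLienard F g G a) (p : ℝ × ℝ) :
    lienardField F g (-p) = -lienardField F g p := by
  refine Prod.ext ?_ ?_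
  · simp only [lienardField, Prod.fst_neg, Prod.snd_neg, h.F_neg]
    ring
  · simp only [lienardField, Prod.fst_neg, Prod.snd_neg, h.g_neg]

/-- The energy `u² / 2 + G x` along a solution. -/
lemma hasDerivAt_energy (h : IsLienard F g G a) {γ : ℝ → ℝ × ℝ} {t : ℝ}
    (hγ : HasDerivAt γ (lienardField F g (γ t)) t) :
    HasDerivAt (fun s => (γ s).2 ^ 2 / 2 + G (γ s).1) (-(g (γ t).1 * F (γ t).1)) t := by
  refine (((hγ.lienard_snd.pow 2).div_const 2).add
    ((h.hasDerivAt_G _).comp t hγ.lienard_fst)).congr_deriv ?_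
  push_cast
  ring

/-- The horizontal velocity `u - F x` along a solution. -/
lemma hasDerivAt_velocity (h : IsLienard F g G a) {γ : ℝ → ℝ × ℝ} {t : ℝ}
    (hγ : HasDerivAt γ (lienardField F g (γ t)) t) :
    HasDerivAt (fun s => (γ s).2 - F (γ s).1)
      (-g (γ t).1 - _root_.deriv F (γ t).1 * ((γ t).2 - F (γ t).1)) t :=
  hγ.lienard_snd.sub
    (((h.contDiff_F.differentiable one_ne_zero _).hasDerivAt).comp t hγ.lienard_fst)

end IsLienard

namespace IsLienardArc

variable {γ : ℝ → ℝ × ℝ} {T p q : ℝ}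

lemma fst_nonneg (A : IsLienardArc F g γ T p q) {t : ℝ} (ht : t ∈ Icc 0 T) : 0 ≤ (γ t).1 := by
  rcases ht.1.eq_or_lt with rfl | h0
  · simp [A.start]
  rcases ht.2.eq_or_lt with rfl | hT
  · simp [A.finish]
  exact (A.pos t ⟨h0, hT⟩).le

lemma continuousOn (A : IsLienardArc F g γ T p q) : ContinuousOn γ (Icc 0 T) :=
  fun t ht => (A.deriv t ht).continuousAt.continuousWithinAt

lemma continuousOn_snd (A : IsLienardArc F g γ T p q) :
    ContinuousOn (fun t => (γ t).2) (Icc 0 T) :=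
  continuous_snd.comp_continuousOn A.continuousOn

lemma continuousOn_fst (A : IsLienardArc F g γ T p q) :
    ContinuousOn (fun t => (γ t).1) (Icc 0 T) :=
  continuous_fst.comp_continuousOn A.continuousOn

lemma left_mem (A : IsLienardArc F g γ T p q) : 0 ∈ Icc 0 T := left_mem_Icc.2 A.T_pos.le

lemma right_mem (A : IsLienardArc F g γ T p q) : T ∈ Icc 0 T := right_mem_Icc.2 A.T_pos.le

lemma strictAntiOn_snd (h : IsLienard F g G a) (A : IsLienardArc F g γ T p q) :
    StrictAntiOn (fun t => (γ t).2) (Icc 0 T) := by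
  refine strictAntiOn_of_hasDerivWithinAt_neg (convex_Icc 0 T) A.continuousOn_snd
    (f' := fun t => -g (γ t).1) ?_ ?_ <;> intro t ht <;> rw [interior_Icc] at ht
  · exact (A.deriv t (Ioo_subset_Icc_self ht)).lienard_snd.hasDerivWithinAt
  · exact neg_neg_of_pos (h.g_pos _ (A.pos t ht))

lemma exists_snd_eq (A : IsLienardArc F g γ T p q) {w : ℝ} (hw : w ∈ Icc (-q) p) :
    ∃ t ∈ Icc 0 T, (γ t).2 = w := by
  have := intermediate_value_Icc' A.T_pos.le A.continuousOn_snd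
  simp only [A.start, A.finish] at this
  exact this hw

/-- An arc is a graph over the `u`-axis; the potential energy along it satisfies Filippov's
equation. -/
lemma exists_graph (h : IsLienard F g G a) (A : IsLienardArc F g γ T p q) :
    ∃ X : ℝ → ℝ, (∀ t ∈ Icc 0 T, X (γ t).2 = (γ t).1) ∧ ContinuousOn X (Icc (-q) p) ∧
      ∀ w ∈ Ioo (-q) p, HasDerivAt (fun w => G (X w)) (F (X w) - w) w := by
  obtain ⟨Q, hQ, hQc, hQd⟩ := exists_reparametrization (p := fun t => -(γ t).2)
    (q := fun t => (γ t).1) (p' := fun t => g (γ t).1) (q' := fun t => (γ t).2 - F (γ t).1)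
    A.T_pos.le (fun t ht => (A.deriv t ht).lienard_snd.fun_neg.congr_deriv (neg_neg _))
    (fun t ht => (A.deriv t ht).lienard_fst) (fun t ht => h.g_pos _ (A.pos t ht))
  simp only [A.start, A.finish, neg_neg] at hQc
  refine ⟨fun w => Q (-w), hQ, ?_, fun w hw => ?_⟩
  · exact hQc.comp continuous_neg.continuousOn
      fun w hw => ⟨neg_le_neg hw.2, neg_le.1 hw.1⟩
  · obtain ⟨t, ht, rfl⟩ := A.exists_snd_eq (Ioo_subset_Icc_self hw)
    have ht' : t ∈ Ioo 0 T := by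
      refine ⟨lt_of_le_of_ne ht.1 ?_, lt_of_le_of_ne ht.2 ?_⟩
      · rintro rfl
        simp [A.start] at hw
      · rintro rfl
        simp [A.finish] at hw
    have hg := h.g_pos _ (A.pos t ht')
    have h1 := (hQd t ht').comp (γ t).2 (hasDerivAt_neg _)
    have h2 := (h.hasDerivAt_G (Q (-(γ t).2))).comp (γ t).2 h1
    refine h2.congr_deriv ?_
    simp only [hQ t ht]
    field_simp
    ring

variable {γ₁ γ₂ : ℝ → ℝ × ℝ} {T₁ T₂ p₁ p₂ q₁ q₂ : ℝ}

/-- Two arcs with a common point have the same starting point. -/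
lemma start_eq_of_meet (h : IsLienard F g G a) (A₁ : IsLienardArc F g γ₁ T₁ p₁ q₁)
    (A₂ : IsLienardArc F g γ₂ T₂ p₂ q₂) {t₁ t₂ : ℝ} (ht₁ : t₁ ∈ Icc 0 T₁) (ht₂ : t₂ ∈ Icc 0 T₂)
    (heq : γ₁ t₁ = γ₂ t₂) : p₁ = p₂ := by
  wlog hle : t₁ ≤ t₂ generalizing γ₁ γ₂ T₁ T₂ p₁ p₂ q₁ q₂ t₁ t₂
  · exact (this A₂ A₁ ht₂ ht₁ heq.symm (not_le.1 hle).le).symm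
  have hE : EqOn γ₁ (fun t => γ₂ (t + (t₂ - t₁))) (Icc 0 t₁) := by
    refine eqOn_of_hasDerivAt_of_contDiff h.contDiff_field
      (fun t ht => A₁.deriv t ⟨ht.1, ht.2.trans ht₁.2⟩) (fun t ht => ?_) (right_mem_Icc.2 ht₁.1)
      (by simpa using heq)
    exact (A₂.deriv (t + (t₂ - t₁)) ⟨by linarith [ht.1], by linarith [ht.2, ht₂.2]⟩).comp_add_const
      t (t₂ - t₁)
  have h0 := hE (left_mem_Icc.2 ht₁.1)
  simp only [zero_add, A₁.start] at h0
  rcases hle.eq_or_lt with rfl | hlt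
  · rw [sub_self, A₂.start] at h0
    exact congrArg Prod.snd h0
  exfalso
  rcases (show t₂ - t₁ ≤ T₂ by linarith [ht₂.2, ht₁.1]).eq_or_lt with hT | hT
  · rw [hT, A₂.finish] at h0
    have := congrArg Prod.snd h0
    simp only at this
    linarith [A₁.p_pos, A₂.q_pos]
  · have := A₂.pos (t₂ - t₁) ⟨by linarith, hT⟩
    rw [← h0] at this
    exact lt_irrefl _ this

/-- Arcs are nested: at the same height, the arc starting higher lies further out. -/
lemma fst_lt_fst (h : IsLienard F g G a) (A₁ : IsLienardArc F g γ₁ T₁ p₁ q₁)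
    (A₂ : IsLienardArc F g γ₂ T₂ p₂ q₂) (hp : p₁ < p₂) {t₁ t₂ : ℝ} (ht₁ : t₁ ∈ Icc 0 T₁)
    (ht₂ : t₂ ∈ Icc 0 T₂) (heq : (γ₁ t₁).2 = (γ₂ t₂).2) : (γ₁ t₁).1 < (γ₂ t₂).1 := by
  obtain ⟨X₁, hX₁, hX₁c, -⟩ := A₁.exists_graph h
  obtain ⟨X₂, hX₂, hX₂c, -⟩ := A₂.exists_graph h
  have hmem : ∀ {γ : ℝ → ℝ × ℝ} {T p q : ℝ} (_ : IsLienardArc F g γ T p q) {t : ℝ},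
      t ∈ Icc 0 T → (γ t).2 ∈ Icc (-q) p := by
    intro γ T p q A t ht
    have hanti := (A.strictAntiOn_snd h).antitoneOn
    have h1 := hanti A.left_mem ht ht.1
    have h2 := hanti ht A.right_mem ht.2
    simp only [A.start, A.finish] at h1 h2
    exact ⟨h2, h1⟩
  have hw₁ := hmem A₁ ht₁
  have hw₂ := hmem A₂ ht₂
  rw [← heq] at hw₂
  by_contra hcon
  rw [not_lt, ← hX₁ t₁ ht₁, ← hX₂ t₂ ht₂, ← heq] at hcon
  have hsub₁ : Icc (γ₁ t₁).2 p₁ ⊆ Icc (-q₁) p₁ := Icc_subset_Icc_left hw₁.1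
  have hsub₂ : Icc (γ₁ t₁).2 p₁ ⊆ Icc (-q₂) p₂ := Icc_subset_Icc hw₂.1 hp.le
  have hend : X₁ p₁ - X₂ p₁ ≤ 0 := by
    have e₁ : X₁ p₁ = 0 := by simpa [A₁.start] using hX₁ 0 A₁.left_mem
    obtain ⟨s, hs, hsp⟩ := A₂.exists_snd_eq (w := p₁) ⟨by linarith [A₁.p_pos, A₂.q_pos], hp.le⟩
    have e₂ : X₂ p₁ = (γ₂ s).1 := by rw [← hsp, hX₂ s hs]
    have := A₂.fst_nonneg hs
    linarith
  obtain ⟨w, hw, hw0⟩ := intermediate_value_Icc' hw₁.2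
    ((hX₁c.mono hsub₁).sub (hX₂c.mono hsub₂)) ⟨hend, sub_nonneg.2 hcon⟩
  obtain ⟨s₁, hs₁, hs₁w⟩ := A₁.exists_snd_eq (hsub₁ hw)
  obtain ⟨s₂, hs₂, hs₂w⟩ := A₂.exists_snd_eq (hsub₂ hw)
  refine hp.ne (A₁.start_eq_of_meet h A₂ hs₁ hs₂ (Prod.ext ?_ (hs₁w.trans hs₂w.symm)))
  rw [← hX₁ s₁ hs₁, ← hX₂ s₂ hs₂, hs₁w, hs₂w]
  exact sub_eq_zero.1 hw0

/-- The half return map is strictly increasing. -/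
lemma finish_lt_finish (h : IsLienard F g G a) (A₁ : IsLienardArc F g γ₁ T₁ p₁ q₁)
    (A₂ : IsLienardArc F g γ₂ T₂ p₂ q₂) (hp : p₁ < p₂) : q₁ < q₂ := by
  by_contra! hle
  obtain ⟨s, hs, hsq⟩ := A₁.exists_snd_eq (w := -q₂)
    ⟨neg_le_neg hle, by linarith [A₁.p_pos, A₂.q_pos]⟩
  have := A₁.fst_lt_fst h A₂ hp hs A₂.right_mem (by simp [hsq, A₂.finish])
  have h0 := A₁.fst_nonneg hs
  simp only [A₂.finish] at this
  linarith

/-- Along an arc the horizontal velocity `u - F x` changes sign exactly once. -/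
lemma exists_turning_point (h : IsLienard F g G a) (A : IsLienardArc F g γ T p q) :
    ∃ τ ∈ Ioo 0 T, (∀ t ∈ Ico 0 τ, F (γ t).1 < (γ t).2) ∧
      ∀ t ∈ Ioc τ T, (γ t).2 < F (γ t).1 := by
  have hvc : ContinuousOn (fun t => (γ t).2 - F (γ t).1) (Icc 0 T) :=
    fun t ht => (h.hasDerivAt_velocity (A.deriv t ht)).continuousAt.continuousWithinAt
  have hv0 : (γ 0).2 - F (γ 0).1 = p := by simp [A.start, h.F_zero]
  have hvT : (γ T).2 - F (γ T).1 = -q := by simp [A.finish, h.F_zero]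
  have hneg : ∀ t ∈ Icc 0 T, (γ t).2 - F (γ t).1 = 0 →
      -g (γ t).1 - _root_.deriv F (γ t).1 * ((γ t).2 - F (γ t).1) < 0 := by
    intro t ht h0
    have ht' : t ∈ Ioo 0 T := by
      refine ⟨lt_of_le_of_ne ht.1 ?_, lt_of_le_of_ne ht.2 ?_⟩
      · rintro rfl
        exact A.p_pos.ne' (hv0 ▸ h0)
      · rintro rfl
        exact (neg_neg_of_pos A.q_pos).ne (hvT ▸ h0)
    have := h.g_pos _ (A.pos t ht')
    rw [h0]
    linarith
  obtain ⟨τ, hτ, hτ0⟩ := intermediate_value_Icc' A.T_pos.le hvc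
    (show (0 : ℝ) ∈ Icc _ _ by
      rw [hv0, hvT]
      exact ⟨(neg_neg_of_pos A.q_pos).le, A.p_pos.le⟩)
  simp only at hτ0
  have hτ' : τ ∈ Ioo 0 T := by
    refine ⟨lt_of_le_of_ne hτ.1 ?_, lt_of_le_of_ne hτ.2 ?_⟩
    · rintro rfl
      exact A.p_pos.ne' (hv0 ▸ hτ0)
    · rintro rfl
      exact (neg_neg_of_pos A.q_pos).ne (hvT ▸ hτ0)
  refine ⟨τ, hτ', fun t ht => ?_, fun t ht => ?_⟩
  · have hmem : ∀ s ∈ Icc 0 τ, τ - s ∈ Icc 0 T :=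
      fun s hs => ⟨by linarith [hs.2], by linarith [hs.1, hτ.2]⟩
    have := neg_of_deriv_neg_of_zero (a := 0) (b := τ)
      (f := fun s => -((γ (τ - s)).2 - F (γ (τ - s)).1))
      (fun s hs => ((h.hasDerivAt_velocity (A.deriv _ (hmem s hs))).comp_const_sub τ s).neg)
      (by simp [hτ0]) (fun s hs h0 => by
        rw [neg_neg]
        exact hneg _ (hmem s hs) (neg_eq_zero.1 h0)) (τ - t)
      ⟨by linarith [ht.2], by linarith [ht.1]⟩
    simp only [sub_sub_cancel] at this
    linarith
  · have := neg_of_deriv_neg_of_zero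
      (fun s (hs : s ∈ Icc τ T) => h.hasDerivAt_velocity (A.deriv s ⟨hτ.1.trans hs.1, hs.2⟩))
      hτ0.le (fun s hs h0 => hneg s ⟨hτ.1.trans hs.1, hs.2⟩ h0) t ht
    linarith

/-- A part of an arc which is a graph `x ↦ (x, Q x)` over `[0, a]` inside one of the regions
`F x < u` and `u < F x`. -/
structure IsBranch (F g : ℝ → ℝ) (a : ℝ) (γ : ℝ → ℝ × ℝ) (T : ℝ) (Q : ℝ → ℝ) : Prop where
  continuousOn : ContinuousOn Q (Icc 0 a)
  hasDerivAt : ∀ x ∈ Ioo 0 a, HasDerivAt Q (-g x / (Q x - F x)) x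
  mem : ∀ x ∈ Icc 0 a, ∃ t ∈ Icc 0 T, γ t = (x, Q x)

/-- An arc that does not lose energy passes beyond `x = a`, and is composed of an upper branch, a
middle part in `a ≤ x` and a lower branch. -/
lemma exists_branches (h : IsLienard F g G a) (A : IsLienardArc F g γ T p p) :
    ∃ α β : ℝ, ∃ Q R : ℝ → ℝ, 0 < α ∧ α < β ∧ β < T ∧ γ α = (a, Q a) ∧ γ β = (a, R a) ∧
      (∀ t ∈ Icc α β, a ≤ (γ t).1) ∧ Q 0 = p ∧ R 0 = -p ∧
      IsBranch F g a γ T Q ∧ IsBranch F g a γ T R ∧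
      ∀ x ∈ Icc 0 a, F x < Q x ∧ R x < F x := by
  obtain ⟨τ, hτ, hpos, hneg⟩ := A.exists_turning_point h
  have hmono : StrictMonoOn (fun t => (γ t).1) (Icc 0 τ) := by
    have hsub : Icc 0 τ ⊆ Icc 0 T := Icc_subset_Icc_right hτ.2.le
    refine strictMonoOn_of_hasDerivWithinAt_pos (convex_Icc 0 τ) (A.continuousOn_fst.mono hsub)
      (f' := fun t => (γ t).2 - F (γ t).1) ?_ ?_ <;> intro t ht
    · exact (A.deriv t (hsub (interior_subset ht))).lienard_fst.hasDerivWithinAt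
    · rw [interior_Icc] at ht
      exact sub_pos.2 (hpos t ⟨ht.1.le, ht.2⟩)
  have hanti : StrictAntiOn (fun t => (γ t).1) (Icc τ T) := by
    have hsub : Icc τ T ⊆ Icc 0 T := Icc_subset_Icc_left hτ.1.le
    refine strictAntiOn_of_hasDerivWithinAt_neg (convex_Icc τ T) (A.continuousOn_fst.mono hsub)
      (f' := fun t => (γ t).2 - F (γ t).1) ?_ ?_ <;> intro t ht
    · exact (A.deriv t (hsub (interior_subset ht))).lienard_fst.hasDerivWithinAt
    · rw [interior_Icc] at ht
      exact sub_neg.2 (hneg t ⟨ht.1, ht.2.le⟩)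
  have hEc : ContinuousOn (fun s => (γ s).2 ^ 2 / 2 + G (γ s).1) (Icc 0 T) :=
    fun t ht => (h.hasDerivAt_energy (A.deriv t ht)).continuousAt.continuousWithinAt
  have hτa : a < (γ τ).1 := by
    by_contra! hle
    have h1 : StrictMonoOn (fun s => (γ s).2 ^ 2 / 2 + G (γ s).1) (Icc 0 τ) := by
      have hsub : Icc 0 τ ⊆ Icc 0 T := Icc_subset_Icc_right hτ.2.le
      refine strictMonoOn_of_hasDerivWithinAt_pos (convex_Icc 0 τ) (hEc.mono hsub)
        (f' := fun t => -(g (γ t).1 * F (γ t).1)) ?_ ?_ <;> intro t ht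
      · exact (h.hasDerivAt_energy (A.deriv t (hsub (interior_subset ht)))).hasDerivWithinAt
      · rw [interior_Icc] at ht
        have hx := A.pos t ⟨ht.1, ht.2.trans hτ.2⟩
        have hxa : (γ t).1 < a :=
          (hmono ⟨ht.1.le, ht.2.le⟩ (right_mem_Icc.2 hτ.1.le) ht.2).trans_le hle
        exact neg_pos.2 (mul_neg_of_pos_of_neg (h.g_pos _ hx) (h.F_lt_zero _ ⟨hx, hxa⟩))
    have h2 : MonotoneOn (fun s => (γ s).2 ^ 2 / 2 + G (γ s).1) (Icc τ T) := by
      have hsub : Icc τ T ⊆ Icc 0 T := Icc_subset_Icc_left hτ.1.le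
      refine monotoneOn_of_hasDerivWithinAt_nonneg (convex_Icc τ T) (hEc.mono hsub)
        (f' := fun t => -(g (γ t).1 * F (γ t).1)) ?_ ?_ <;> intro t ht
      · exact (h.hasDerivAt_energy (A.deriv t (hsub (interior_subset ht)))).hasDerivWithinAt
      · have ht := interior_subset ht
        have hx := A.fst_nonneg (hsub ht)
        have hxa := (hanti.antitoneOn (left_mem_Icc.2 hτ.2.le) ht ht.1).trans hle
        exact neg_nonneg.2 (mul_nonpos_of_nonneg_of_nonpos (h.g_nonneg hx) (h.F_nonpos ⟨hx, hxa⟩))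
    have h3 := h1 (left_mem_Icc.2 hτ.1.le) (right_mem_Icc.2 hτ.1.le) hτ.1
    have h4 := h2 (left_mem_Icc.2 hτ.2.le) (right_mem_Icc.2 hτ.2.le) hτ.2.le
    simp only [A.start, A.finish] at h3 h4
    linarith
  obtain ⟨α, hα, hαa⟩ := intermediate_value_Ioo hτ.1.le
    (A.continuousOn_fst.mono (Icc_subset_Icc_right hτ.2.le))
    (show a ∈ Ioo _ _ from ⟨by simpa [A.start] using h.a_pos, hτa⟩)
  obtain ⟨β, hβ, hβa⟩ := intermediate_value_Ioo' hτ.2.le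
    (A.continuousOn_fst.mono (Icc_subset_Icc_left hτ.1.le))
    (show a ∈ Ioo _ _ from ⟨by simpa [A.finish] using h.a_pos, hτa⟩)
  simp only at hαa hβa
  have hsα : Icc 0 α ⊆ Icc 0 T := Icc_subset_Icc_right (hα.2.trans hτ.2).le
  have hsβ : Icc β T ⊆ Icc 0 T := Icc_subset_Icc_left (hτ.1.trans hβ.1).le
  obtain ⟨Q, hQ, hQc, hQd⟩ := exists_reparametrization hα.1.le
    (fun t ht => (A.deriv t (hsα ht)).lienard_fst) (fun t ht => (A.deriv t (hsα ht)).lienard_snd)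
    (fun t ht => sub_pos.2 (hpos t ⟨ht.1.le, ht.2.trans hα.2⟩))
  obtain ⟨R, hR, hRc, hRd⟩ := exists_reparametrization hβ.2.le
    (fun t ht => (A.deriv t (hsβ ht)).lienard_fst.fun_neg)
    (fun t ht => (A.deriv t (hsβ ht)).lienard_snd)
    (fun t ht => neg_pos.2 (sub_neg.2 (hneg t ⟨hβ.1.trans ht.1, ht.2.le⟩)))
  simp only [A.start, A.finish, hαa, hβa, neg_zero] at hQc hRc
  have hQt : ∀ x ∈ Icc 0 a, ∃ t ∈ Icc 0 α, γ t = (x, Q x) := by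
    intro x hx
    obtain ⟨t, ht, hxt⟩ := intermediate_value_Icc hα.1.le (A.continuousOn_fst.mono hsα)
      (show x ∈ Icc _ _ by simpa [A.start, hαa] using hx)
    simp only at hxt
    exact ⟨t, ht, Prod.ext hxt (by rw [← hQ t ht, hxt])⟩
  have hRt : ∀ x ∈ Icc 0 a, ∃ t ∈ Icc β T, γ t = (x, R (-x)) := by
    intro x hx
    obtain ⟨t, ht, hxt⟩ := intermediate_value_Icc' hβ.2.le (A.continuousOn_fst.mono hsβ)
      (show x ∈ Icc _ _ by simpa [A.finish, hβa] using hx)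
    simp only at hxt
    exact ⟨t, ht, Prod.ext hxt (by rw [← hR t ht, hxt])⟩
  have hQα : γ α = (a, Q a) :=
    Prod.ext hαa (by rw [← hQ α (right_mem_Icc.2 hα.1.le), hαa])
  have hRβ : γ β = (a, R (-a)) :=
    Prod.ext hβa (by rw [← hR β (left_mem_Icc.2 hβ.2.le), hβa])
  refine ⟨α, β, Q, fun x => R (-x), hα.1, hα.2.trans hβ.1, hβ.2, hQα, hRβ, fun t ht => ?_,
    ?_, ?_, ⟨hQc, fun x hx => ?_, fun x hx => ?_⟩, ⟨?_, fun x hx => ?_, fun x hx => ?_⟩,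
    fun x hx => ⟨?_, ?_⟩⟩
  · rcases le_total t τ with htτ | htτ
    · rw [← hαa]
      exact hmono.monotoneOn ⟨hα.1.le, hα.2.le⟩ ⟨hα.1.le.trans ht.1, htτ⟩ ht.1
    · rw [← hβa]
      exact hanti.antitoneOn ⟨htτ, ht.2.trans hβ.2.le⟩ ⟨hβ.1.le, hβ.2.le⟩ ht.2
  · simpa [A.start] using hQ 0 (left_mem_Icc.2 hα.1.le)
  · simpa [A.finish] using hR T (right_mem_Icc.2 hβ.2.le)
  · obtain ⟨t, ht, hxt⟩ := hQt x (Ioo_subset_Icc_self hx)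
    have ht' : t ∈ Ioo 0 α := by
      refine ⟨lt_of_le_of_ne ht.1 ?_, lt_of_le_of_ne ht.2 ?_⟩
      · rintro rfl
        rw [A.start] at hxt
        exact hx.1.ne (congrArg Prod.fst hxt)
      · rintro rfl
        rw [hQα] at hxt
        exact hx.2.ne' (congrArg Prod.fst hxt)
    have := hQd t ht'
    simp only [hxt] at this
    exact this
  · obtain ⟨t, ht, hxt⟩ := hQt x hx
    exact ⟨t, hsα ht, hxt⟩
  · exact hRc.comp continuous_neg.continuousOn
      fun x hx => ⟨neg_le_neg hx.2, neg_nonpos.2 hx.1⟩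
  · obtain ⟨t, ht, hxt⟩ := hRt x (Ioo_subset_Icc_self hx)
    have ht' : t ∈ Ioo β T := by
      refine ⟨lt_of_le_of_ne ht.1 ?_, lt_of_le_of_ne ht.2 ?_⟩
      · rintro rfl
        rw [hRβ] at hxt
        exact hx.2.ne' (congrArg Prod.fst hxt)
      · rintro rfl
        rw [A.finish] at hxt
        exact hx.1.ne (congrArg Prod.fst hxt)
    have := (hRd t ht')
    simp only [hxt] at this
    refine (this.comp x (hasDerivAt_neg x)).congr_deriv ?_
    rw [div_neg, neg_mul_neg, mul_one]
  · obtain ⟨t, ht, hxt⟩ := hRt x hx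
    exact ⟨t, hsβ ht, hxt⟩
  · obtain ⟨t, ht, hxt⟩ := hQt x hx
    have := hpos t ⟨ht.1, ht.2.trans_lt hα.2⟩
    rwa [hxt] at this
  · obtain ⟨t, ht, hxt⟩ := hRt x hx
    have := hneg t ⟨hβ.1.trans_le ht.1, ht.2⟩
    rwa [hxt] at this

/-- The gap between the squares of two branches shrinks over `[0, a]`. -/
lemma IsBranch.sq_sub_sq_le (h : IsLienard F g G a) (A₁ : IsLienardArc F g γ₁ T₁ p₁ q₁)
    (A₂ : IsLienardArc F g γ₂ T₂ p₂ q₂) (hp : p₁ ≠ p₂) {Q₁ Q₂ : ℝ → ℝ}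
    (B₁ : IsBranch F g a γ₁ T₁ Q₁) (B₂ : IsBranch F g a γ₂ T₂ Q₂) (h0 : Q₁ 0 < Q₂ 0)
    (hside : ∀ x ∈ Icc 0 a, 0 < (Q₁ x - F x) * (Q₂ x - F x)) :
    Q₁ a < Q₂ a ∧ Q₂ a ^ 2 - Q₁ a ^ 2 ≤ Q₂ 0 ^ 2 - Q₁ 0 ^ 2 := by
  have hlt : ∀ x ∈ Icc 0 a, Q₁ x < Q₂ x := by
    intro x hx
    by_contra! hle
    have hsub : Icc 0 x ⊆ Icc 0 a := Icc_subset_Icc_right hx.2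
    obtain ⟨y, hy, hy0⟩ := intermediate_value_Icc' hx.1
      ((B₂.continuousOn.mono hsub).sub (B₁.continuousOn.mono hsub))
      ⟨sub_nonpos.2 hle, (sub_pos.2 h0).le⟩
    obtain ⟨t₁, ht₁, e₁⟩ := B₁.mem y (hsub hy)
    obtain ⟨t₂, ht₂, e₂⟩ := B₂.mem y (hsub hy)
    refine hp (A₁.start_eq_of_meet h A₂ ht₁ ht₂ ?_)
    rw [e₁, e₂, sub_eq_zero.1 hy0]
  have ha := right_mem_Icc.2 h.a_pos.le
  refine ⟨hlt a ha, ?_⟩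
  have hanti : AntitoneOn (fun x => Q₂ x ^ 2 - Q₁ x ^ 2) (Icc 0 a) := by
    refine antitoneOn_of_hasDerivWithinAt_nonpos (convex_Icc 0 a)
      ((B₂.continuousOn.pow 2).sub (B₁.continuousOn.pow 2))
      (f' := fun x => 2 * (g x * F x * (Q₂ x - Q₁ x)) / ((Q₁ x - F x) * (Q₂ x - F x))) ?_ ?_ <;>
      intro x hx
    · rw [interior_Icc] at hx
      have hs := hside x (Ioo_subset_Icc_self hx)
      have h1 : Q₁ x - F x ≠ 0 := left_ne_zero_of_mul hs.ne'
      have h2 : Q₂ x - F x ≠ 0 := right_ne_zero_of_mul hs.ne'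
      refine ((((B₂.hasDerivAt x hx).pow 2).sub ((B₁.hasDerivAt x hx).pow 2)).congr_deriv
        ?_).hasDerivWithinAt
      field_simp
      ring
    · have hx := interior_subset hx
      refine div_nonpos_of_nonpos_of_nonneg ?_ (hside x hx).le
      exact mul_nonpos_of_nonneg_of_nonpos zero_le_two (mul_nonpos_of_nonpos_of_nonneg
        (mul_nonpos_of_nonneg_of_nonpos (h.g_nonneg hx.1) (h.F_nonpos hx))
        (sub_pos.2 (hlt x hx)).le)
  exact hanti (left_mem_Icc.2 h.a_pos.le) ha h.a_pos.le

/-- At most one arc joins `(0, p)` to `(0, -p)` for some `p`. -/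
lemma not_lt_of_closed (h : IsLienard F g G a) (A₁ : IsLienardArc F g γ₁ T₁ p₁ p₁)
    (A₂ : IsLienardArc F g γ₂ T₂ p₂ p₂) : ¬ p₁ < p₂ := by
  intro hp
  obtain ⟨α₁, β₁, Q₁, R₁, hα₁, hαβ₁, hβ₁, eα₁, eβ₁, hmid₁, hQ₁, hR₁, BQ₁, BR₁, hs₁⟩ :=
    A₁.exists_branches h
  obtain ⟨α₂, β₂, Q₂, R₂, hα₂, hαβ₂, hβ₂, eα₂, eβ₂, hmid₂, hQ₂, hR₂, BQ₂, BR₂, hs₂⟩ :=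
    A₂.exists_branches h
  obtain ⟨hQlt, hQle⟩ := IsBranch.sq_sub_sq_le h A₁ A₂ hp.ne BQ₁ BQ₂ (by rwa [hQ₁, hQ₂])
    fun x hx => mul_pos (sub_pos.2 (hs₁ x hx).1) (sub_pos.2 (hs₂ x hx).1)
  obtain ⟨hRlt, hRle⟩ := IsBranch.sq_sub_sq_le h A₂ A₁ hp.ne' BR₂ BR₁
    (by rw [hR₁, hR₂]; exact neg_lt_neg hp)
    fun x hx => mul_pos_of_neg_of_neg (sub_neg.2 (hs₂ x hx).2) (sub_neg.2 (hs₁ x hx).2)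
  rw [hQ₁, hQ₂] at hQle
  rw [hR₁, hR₂] at hRle
  have hsub₁ : Icc α₁ β₁ ⊆ Icc 0 T₁ := Icc_subset_Icc hα₁.le hβ₁.le
  have hsub₂ : Icc α₂ β₂ ⊆ Icc 0 T₂ := Icc_subset_Icc hα₂.le hβ₂.le
  have hRQ : R₁ a < Q₁ a := by
    have := hs₁ a (right_mem_Icc.2 h.a_pos.le)
    exact this.2.trans this.1
  obtain ⟨X₁, hX₁, hX₁c, hX₁d⟩ := A₁.exists_graph h
  obtain ⟨X₂, hX₂, hX₂c, hX₂d⟩ := A₂.exists_graph h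
  have hmid : ∀ w ∈ Icc (R₁ a) (Q₁ a), (∃ t ∈ Icc α₁ β₁, (γ₁ t).2 = w) ∧
      ∃ t ∈ Icc α₂ β₂, (γ₂ t).2 = w := by
    intro w hw
    constructor
    · refine intermediate_value_Icc' hαβ₁.le (A₁.continuousOn_snd.mono hsub₁) ?_
      simpa [eα₁, eβ₁] using hw
    · refine intermediate_value_Icc' hαβ₂.le (A₂.continuousOn_snd.mono hsub₂) ?_
      simp only [eα₂, eβ₂]
      exact ⟨hRlt.le.trans hw.1, hw.2.trans hQlt.le⟩
  have hrange : ∀ {γ : ℝ → ℝ × ℝ} {T p : ℝ}, IsLienardArc F g γ T p p → ∀ {t : ℝ},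
      t ∈ Icc 0 T → (γ t).2 ∈ Icc (-p) p := by
    intro γ T p A t ht
    have hanti := (A.strictAntiOn_snd h).antitoneOn
    have h1 := hanti A.left_mem ht ht.1
    have h2 := hanti ht A.right_mem ht.2
    simp only [A.start, A.finish] at h1 h2
    exact ⟨h2, h1⟩
  have hw₁ : Icc (R₁ a) (Q₁ a) ⊆ Icc (-p₁) p₁ := by
    intro w hw
    obtain ⟨⟨t, ht, rfl⟩, -⟩ := hmid w hw
    exact hrange A₁ (hsub₁ ht)
  have hw₂ : Icc (-p₁) p₁ ⊆ Ioo (-p₂) p₂ := Icc_subset_Ioo (neg_lt_neg hp) hp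
  have hD : StrictMonoOn (fun w => G (X₂ w) - G (X₁ w)) (Icc (R₁ a) (Q₁ a)) := by
    refine strictMonoOn_of_hasDerivWithinAt_pos (convex_Icc _ _) ?_
      (f' := fun w => (F (X₂ w) - w) - (F (X₁ w) - w)) ?_ ?_
    · exact (h.continuous_G.comp_continuousOn
        (hX₂c.mono (hw₁.trans (hw₂.trans Ioo_subset_Icc_self)))).sub
          (h.continuous_G.comp_continuousOn (hX₁c.mono hw₁))
    · intro w hw
      have hmem₁ : w ∈ Ioo (-p₁) p₁ := by
        have := interior_mono hw₁ hw
        rwa [interior_Icc] at this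
      exact ((hX₂d w (hw₂ (Ioo_subset_Icc_self hmem₁))).sub (hX₁d w hmem₁)).hasDerivWithinAt
    · intro w hw
      obtain ⟨⟨t₁, ht₁, e₁⟩, t₂, ht₂, e₂⟩ := hmid w (interior_subset hw)
      have hlt := A₁.fst_lt_fst h A₂ hp (hsub₁ ht₁) (hsub₂ ht₂) (e₁.trans e₂.symm)
      have := h.F_strictMonoOn (hmid₁ t₁ ht₁) (hmid₂ t₂ ht₂) hlt
      simp only [← hX₁ t₁ (hsub₁ ht₁), ← hX₂ t₂ (hsub₂ ht₂), e₁, e₂] at this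
      linarith
  have hE : AntitoneOn (fun s => (γ₂ s).2 ^ 2 / 2 + G (γ₂ s).1) (Icc α₂ β₂) := by
    refine antitoneOn_of_hasDerivWithinAt_nonpos (convex_Icc α₂ β₂)
      (fun t ht => (h.hasDerivAt_energy (A₂.deriv t (hsub₂ ht))).continuousAt.continuousWithinAt)
      (f' := fun t => -(g (γ₂ t).1 * F (γ₂ t).1)) ?_ ?_ <;> intro t ht <;>
      have ht := interior_subset ht
    · exact (h.hasDerivAt_energy (A₂.deriv t (hsub₂ ht))).hasDerivWithinAt
    · have := hmid₂ t ht
      exact neg_nonpos.2 (mul_nonneg (h.g_nonneg (h.a_pos.le.trans this)) (h.F_nonneg this))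
  obtain ⟨-, s, hs, es⟩ := hmid (Q₁ a) (right_mem_Icc.2 hRQ.le)
  obtain ⟨-, r, hr, er⟩ := hmid (R₁ a) (left_mem_Icc.2 hRQ.le)
  have h1 := hE (left_mem_Icc.2 hαβ₂.le) hs hs.1
  have h2 := hE hr (right_mem_Icc.2 hαβ₂.le) hr.2
  have h3 := hD (left_mem_Icc.2 hRQ.le) (right_mem_Icc.2 hRQ.le) hRQ
  have e1 : X₁ (Q₁ a) = a := by
    simpa [eα₁] using hX₁ α₁ (hsub₁ (left_mem_Icc.2 hαβ₁.le))
  have e2 : X₁ (R₁ a) = a := by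
    simpa [eβ₁] using hX₁ β₁ (hsub₁ (right_mem_Icc.2 hαβ₁.le))
  have e3 : X₂ (Q₁ a) = (γ₂ s).1 := by rw [← es, hX₂ s (hsub₂ hs)]
  have e4 : X₂ (R₁ a) = (γ₂ r).1 := by rw [← er, hX₂ r (hsub₂ hr)]
  simp only [e1, e2, e3, e4] at h3
  simp only [es, er, eα₂, eβ₂] at h1 h2
  linarith

end IsLienardArc

lemma HasDerivAt.eventually_lt_of_pos {f : ℝ → ℝ} {f' t : ℝ} (hf : HasDerivAt f f' t)
    (hf' : 0 < f') : (∀ᶠ s in 𝓝[>] t, f t < f s) ∧ ∀ᶠ s in 𝓝[<] t, f s < f t := by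
  have h := (hasDerivAt_iff_tendsto_slope.1 hf).eventually (lt_mem_nhds hf')
  constructor
  · filter_upwards [h.filter_mono (nhdsGT_le_nhdsNE t), self_mem_nhdsWithin] with s hs hts
    rw [slope_def_field, div_pos_iff_of_pos_right (sub_pos.2 hts)] at hs
    linarith
  · filter_upwards [h.filter_mono (nhdsLT_le_nhdsNE t), self_mem_nhdsWithin] with s hs hts
    rw [slope_def_field, ← neg_div_neg_eq,
      div_pos_iff_of_pos_right (neg_pos.2 (sub_neg.2 hts))] at hs
    linarith

/-- A function decreasing at a definite rate takes arbitrarily small values. -/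
lemma exists_lt_of_deriv_le_neg {f f' : ℝ → ℝ} {t₀ c : ℝ}
    (hf : ∀ t, t₀ ≤ t → HasDerivAt f (f' t) t) (hc : 0 < c) (h : ∀ t, t₀ ≤ t → f' t ≤ -c)
    (M : ℝ) : ∃ t, t₀ ≤ t ∧ f t < M := by
  by_contra! hM
  have h0 := hM t₀ le_rfl
  set t := t₀ + (f t₀ - M + 1) / c with ht
  have htt : t₀ ≤ t := by
    have : 0 ≤ (f t₀ - M + 1) / c := by
      apply div_nonneg _ hc.le
      linarith
    linarith
  have := le_of_deriv_nonpos_of_lt (a := t₀) (b := t) (c := f t₀)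
    (f := fun s => f s + c * (s - t₀)) (f' := fun s => f' s + c * 1)
    (fun s hs => (hf s hs.1).add (((hasDerivAt_id s).sub_const t₀).const_mul c))
    (by simp) (fun s hs _ => by linarith [h s hs.1]) t (right_mem_Icc.2 htt)
  have h2 : c * (t - t₀) = f t₀ - M + 1 := by
    rw [ht]
    field_simp
    ring
  have h3 := hM t htt
  linarith

namespace IsLienard

/-- An orbit starting at the origin stays there. -/
lemma eq_zero_of_eq_zero (h : IsLienard F g G a) {γ : ℝ → ℝ × ℝ} {b c t₀ : ℝ}
    (hγ : ∀ t ∈ Icc b c, HasDerivAt γ (lienardField F g (γ t)) t) (ht₀ : t₀ ∈ Icc b c)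
    (h0 : γ t₀ = 0) : ∀ t ∈ Icc b c, γ t = 0 := by
  refine eqOn_of_hasDerivAt_of_contDiff (g := fun _ => 0) h.contDiff_field hγ
    (fun t _ => ?_) ht₀ h0
  have : lienardField F g 0 = 0 := by simp [lienardField, h.F_zero, h.g_zero]
  rw [this]
  exact hasDerivAt_const t 0

/-- An orbit leaving the positive `u`-axis which returns to `x ≤ 0` contains an arc. -/
lemma exists_arc_of_return (h : IsLienard F g G a) {γ : ℝ → ℝ × ℝ} {t₁ p : ℝ} (ht₁ : 0 < t₁)
    (hγ : ∀ t ∈ Icc 0 t₁, HasDerivAt γ (lienardField F g (γ t)) t) (hp : 0 < p)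
    (h0 : γ 0 = (0, p)) (h1 : (γ t₁).1 ≤ 0) :
    ∃ T q : ℝ, T ≤ t₁ ∧ IsLienardArc F g γ T p q := by
  have hxc : ContinuousOn (fun t => (γ t).1) (Icc 0 t₁) :=
    fun t ht => (hγ t ht).lienard_fst.continuousAt.continuousWithinAt
  have hd0 := (hγ 0 (left_mem_Icc.2 ht₁.le)).lienard_fst
  simp only [h0, h.F_zero, sub_zero] at hd0
  have hev := (hd0.eventually_lt_of_pos hp).1
  simp only [h0] at hev
  obtain ⟨c, hc, hcpos⟩ := mem_nhdsGT_iff_exists_Ioo_subset.1 hev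
  have hc : 0 < c := hc
  have hct : c ≤ t₁ := by
    by_contra! hlt
    have : 0 < (γ t₁).1 := hcpos ⟨ht₁, hlt⟩
    linarith
  have hcomp : IsCompact (Icc c t₁ ∩ (fun t => (γ t).1) ⁻¹' Iic 0) := by
    refine isCompact_Icc.of_isClosed_subset ?_ inter_subset_left
    exact (hxc.mono (Icc_subset_Icc_left hc.le)).preimage_isClosed_of_isClosed isClosed_Icc
      isClosed_Iic
  obtain ⟨T, ⟨hT, hTx⟩, hTmin⟩ := hcomp.exists_isLeast ⟨t₁, right_mem_Icc.2 hct, h1⟩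
  have hT0 : 0 < T := hc.trans_le hT.1
  have hTmem : T ∈ Icc 0 t₁ := ⟨hT0.le, hT.2⟩
  have hpos : ∀ t ∈ Ioo 0 T, 0 < (γ t).1 := by
    intro t ht
    by_contra! hle
    rcases lt_or_ge t c with htc | htc
    · have : 0 < (γ t).1 := hcpos ⟨ht.1, htc⟩
      linarith
    · exact (hTmin ⟨⟨htc, ht.2.le.trans hT.2⟩, hle⟩).not_gt ht.2
  have hleft : ∀ᶠ s in 𝓝[<] T, 0 < (γ s).1 := by
    filter_upwards [Ioo_mem_nhdsLT hT0] with s hs using hpos s hs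
  have hx0 : (γ T).1 = 0 := by
    refine le_antisymm hTx (ge_of_tendsto (x := 𝓝[<] T) (f := fun s => (γ s).1) ?_
      (hleft.mono fun s hs => hs.le))
    exact (hγ T hTmem).lienard_fst.continuousAt.tendsto.mono_left nhdsWithin_le_nhds
  have hu : (γ T).2 ≤ 0 := by
    by_contra! hu
    have hd := (hγ T hTmem).lienard_fst
    rw [hx0, h.F_zero, sub_zero] at hd
    obtain ⟨s, hs1, hs2⟩ := (hleft.and (hd.eventually_lt_of_pos hu).2).exists
    rw [hx0] at hs2
    linarith
  have hu0 : (γ T).2 ≠ 0 := by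
    intro hu0
    have := h.eq_zero_of_eq_zero hγ hTmem (Prod.ext hx0 hu0) 0 (left_mem_Icc.2 ht₁.le)
    rw [h0] at this
    exact hp.ne' (congrArg Prod.snd this)
  exact ⟨T, -(γ T).2, hT.2, hT0, hp, neg_pos.2 (lt_of_le_of_ne hu hu0),
    fun t ht => hγ t ⟨ht.1, ht.2.trans hT.2⟩, h0, Prod.ext hx0 (neg_neg _).symm, hpos⟩

/-- A bounded forward orbit leaving the positive `u`-axis returns to `x ≤ 0`. -/
lemma exists_return (h : IsLienard F g G a) {γ : ℝ → ℝ × ℝ} {M : ℝ}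
    (hγ : ∀ t, 0 ≤ t → HasDerivAt γ (lienardField F g (γ t)) t)
    (hM : ∀ t, 0 ≤ t → ‖γ t‖ ≤ M) : ∃ t, 0 < t ∧ (γ t).1 ≤ 0 := by
  by_contra! hpos
  have hMx : ∀ t, 0 ≤ t → (γ t).1 ≤ M :=
    fun t ht => (le_abs_self _).trans ((norm_fst_le (γ t)).trans (hM t ht))
  have hMu : ∀ t, 0 ≤ t → -M ≤ (γ t).2 :=
    fun t ht => (abs_le.1 ((norm_snd_le (γ t)).trans (hM t ht))).1
  have hsmall : ∀ δ > 0, ∀ t₀, 0 ≤ t₀ → ∃ t, t₀ ≤ t ∧ (γ t).1 < δ := by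
    intro δ hδ t₀ ht₀
    by_contra! hge
    obtain ⟨x, hx, hmin⟩ := isCompact_Icc.exists_isMinOn
      (nonempty_Icc.2 ((hge t₀ le_rfl).trans (hMx t₀ ht₀))) h.contDiff_g.continuous.continuousOn
    obtain ⟨t, ht, hlt⟩ := exists_lt_of_deriv_le_neg
      (fun t ht => (hγ t (ht₀.trans ht)).lienard_snd) (h.g_pos x (hδ.trans_le hx.1))
      (fun t ht => neg_le_neg (hmin ⟨hge t ht, hMx t (ht₀.trans ht)⟩)) (-M)
    linarith [hMu t (ht₀.trans ht)]
  have hτ : ∃ τ, 0 < τ ∧ (γ τ).2 - F (γ τ).1 < 0 := by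
    by_contra! hge
    obtain ⟨t, ht, hlt⟩ := hsmall _ (hpos 1 one_pos) 1 zero_le_one
    have hmono : MonotoneOn (fun t => (γ t).1) (Icc 1 t) := by
      refine monotoneOn_of_hasDerivWithinAt_nonneg (convex_Icc 1 t)
        (f' := fun t => (γ t).2 - F (γ t).1) (fun s hs => ?_) (fun s hs => ?_) fun s hs => ?_
      · exact (hγ s (by linarith [hs.1])).lienard_fst.continuousAt.continuousWithinAt
      · have hs := interior_subset hs
        exact (hγ s (by linarith [hs.1])).lienard_fst.hasDerivWithinAt
      · have hs := interior_subset hs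
        exact hge s (by linarith [hs.1])
    exact (hmono (left_mem_Icc.2 ht) (right_mem_Icc.2 ht) ht).not_gt hlt
  obtain ⟨τ, hτ0, hτv⟩ := hτ
  have hv : ∀ t, τ ≤ t → (γ t).2 - F (γ t).1 < 0 := by
    intro t ht
    rcases ht.eq_or_lt with rfl | ht
    · exact hτv
    refine neg_of_deriv_neg_of_zero
      (fun s (hs : s ∈ Icc τ t) => h.hasDerivAt_velocity (hγ s (hτ0.le.trans hs.1)))
      hτv.le (fun s hs h0 => ?_) t ⟨ht, le_rfl⟩
    have := h.g_pos _ (hpos s (hτ0.trans_le hs.1))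
    rw [h0]
    linarith
  obtain ⟨t₂, ht₂, hx₂⟩ := hsmall a h.a_pos τ hτ0.le
  have ht₂0 : 0 < t₂ := hτ0.trans_le ht₂
  have hu₂ : (γ t₂).2 < 0 := by
    have h1 := hv t₂ ht₂
    have h2 := h.F_lt_zero _ ⟨hpos t₂ ht₂0, hx₂⟩
    linarith
  have hFc := h.contDiff_F.continuous.tendsto 0
  rw [h.F_zero] at hFc
  obtain ⟨δ, hδ, hF⟩ := Metric.eventually_nhds_iff.1
    (hFc.eventually (lt_mem_nhds (show (γ t₂).2 / 2 < 0 by linarith)))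
  obtain ⟨t₃, ht₃, hx₃⟩ := hsmall δ hδ t₂ ht₂0.le
  have hrate : ∀ t, t₃ ≤ t → (γ t).2 - F (γ t).1 ≤ -(-(γ t₂).2 / 2) := by
    intro t ht
    have htt₂ := ht₃.trans ht
    have hu := le_of_deriv_nonpos_of_lt
      (fun s (hs : s ∈ Icc t₂ t) => (hγ s (ht₂0.le.trans hs.1)).lienard_snd) le_rfl
      (fun s hs _ => neg_nonpos.2 (h.g_nonneg (hpos s (ht₂0.trans_le hs.1)).le)) t
      (right_mem_Icc.2 htt₂)
    have hx := le_of_deriv_nonpos_of_lt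
      (fun s (hs : s ∈ Icc t₃ t) => (hγ s (ht₂0.le.trans (ht₃.trans hs.1))).lienard_fst) le_rfl
      (fun s hs _ => (hv s (ht₂.trans (ht₃.trans hs.1))).le) t (right_mem_Icc.2 ht)
    have hF := @hF (γ t).1 (by
      rw [Real.dist_eq, sub_zero, abs_of_pos (hpos t (ht₂0.trans_le htt₂))]
      exact hx.trans_lt hx₃)
    linarith
  obtain ⟨t, ht, hlt⟩ := exists_lt_of_deriv_le_neg
    (fun t ht => (hγ t (ht₂0.le.trans (ht₃.trans ht))).lienard_fst)
    (by linarith) hrate 0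
  exact (hpos t (ht₂0.trans_le (ht₃.trans ht))).not_gt hlt

end IsLienard

/-- If the Liénard plane carries a coercive function decreasing along orbits outside of a compact
set, there is an antiperiodic orbit. -/
lemma IsLienard.exists_antiperiodic (h : IsLienard F g G a) {V : ℝ × ℝ → ℝ} {c₀ : ℝ}
    (hV : Differentiable ℝ V) (hVb : ∀ c, Bornology.IsBounded {p | V p ≤ c})
    (hV0 : ∀ u, V (0, u) = u ^ 2 / 2)
    (hVd : ∀ p, c₀ < V p → fderiv ℝ V p (lienardField F g p) ≤ 0) :
    ∃ (γ : ℝ → ℝ × ℝ) (T p : ℝ), (∀ t, HasDerivAt γ (lienardField F g (γ t)) t) ∧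
      IsLienardArc F g γ T p p ∧ ∀ t, γ (t + T) = -γ t := by
  have hGa : 0 < G a := by
    have := h.G_strictMonoOn self_mem_Ici h.a_pos.le h.a_pos
    rwa [h.G_zero] at this
  obtain ⟨ε, hε, hεG⟩ : ∃ ε : ℝ, 0 < ε ∧ ε ^ 2 / 2 = G a := by
    refine ⟨√(2 * G a), Real.sqrt_pos.2 (by linarith), ?_⟩
    rw [Real.sq_sqrt (by linarith)]
    ring
  set U := ε + |c₀| + 2 with hU
  have hεU : ε ≤ U := by linarith [abs_nonneg c₀]
  have hcU : c₀ ≤ U ^ 2 / 2 := by nlinarith [abs_nonneg c₀, le_abs_self c₀]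
  obtain ⟨r, hr, hVr⟩ := (hVb (U ^ 2 / 2)).subset_closedBall_lt 0 0
  let χ : ContDiffBump (0 : ℝ × ℝ) := ⟨r, r + 1, hr, lt_add_one r⟩
  set v : ℝ × ℝ → ℝ × ℝ := fun p => χ p • lienardField F g p with hv
  have hvd : ContDiff ℝ 1 v := χ.contDiff.smul h.contDiff_field
  have hvc : HasCompactSupport v := χ.hasCompactSupport.smul_right
  have hvneg : ∀ p, v (-p) = -v p := fun p => by
    simp only [hv, χ.neg, h.field_neg, smul_neg]
  have hveq : ∀ p, V p ≤ U ^ 2 / 2 → v p = lienardField F g p := fun p hp => by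
    have : χ p = 1 := χ.one_of_mem_closedBall (hVr hp)
    simp only [hv, this, one_smul]
  have key : ∀ u ∈ Icc ε U, ∃ (γ : ℝ → ℝ × ℝ) (T q : ℝ), q ∈ Icc ε U ∧
      (∀ t, HasDerivAt γ (v (γ t)) t) ∧ (∀ t, 0 ≤ t → V (γ t) ≤ U ^ 2 / 2) ∧
      IsLienardArc F g γ T u q := by
    intro u hu
    have hu0 : 0 < u := hε.trans_le hu.1
    obtain ⟨γ, hγ0, hγ⟩ := exists_forall_hasDerivAt_of_hasCompactSupport hvd hvc (0, u)
    have hVγ : ∀ t, 0 ≤ t → V (γ t) ≤ U ^ 2 / 2 := by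
      intro t ht
      refine le_of_deriv_nonpos_of_lt (f := V ∘ γ)
        (fun s _ => (hV (γ s)).hasFDerivAt.comp_hasDerivAt s (hγ s)) ?_ (fun s _ hs => ?_) t
        (right_mem_Icc.2 ht)
      · simp only [Function.comp_apply, hγ0, hV0]
        nlinarith [hu.2]
      · simp only [hv, map_smul, smul_eq_mul]
        exact mul_nonpos_of_nonneg_of_nonpos χ.nonneg (hVd _ (hcU.trans_lt hs))
    have hγ' : ∀ t, 0 ≤ t → HasDerivAt γ (lienardField F g (γ t)) t := fun t ht => by
      rw [← hveq _ (hVγ t ht)]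
      exact hγ t
    obtain ⟨t₁, ht₁, hx₁⟩ := h.exists_return (M := r) hγ' fun t ht => by
      simpa using hVr (hVγ t ht)
    obtain ⟨T, q, -, A⟩ := h.exists_arc_of_return ht₁ (fun t ht => hγ' t ht.1) hu0 hγ0 hx₁
    refine ⟨γ, T, q, ⟨?_, ?_⟩, hγ, hVγ, A⟩
    · have := le_of_deriv_nonpos_of_lt (c := -G a)
        (fun s hs => (h.hasDerivAt_energy (A.deriv s hs)).neg) ?_ (fun s hs hlt => ?_) T
        A.right_mem
      · simp only [Pi.neg_apply, A.finish, h.G_zero] at this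
        exact abs_le_of_sq_le_sq' (by nlinarith) A.q_pos.le |>.2
      · simp only [Pi.neg_apply, A.start, h.G_zero]
        nlinarith [hu.1]
      · have hGx : G (γ s).1 < G a := by
          simp only [Pi.neg_apply] at hlt
          nlinarith [sq_nonneg (γ s).2]
        have hx0 := A.fst_nonneg hs
        have hxa : (γ s).1 < a := (h.G_strictMonoOn.lt_iff_lt hx0 h.a_pos.le).1 hGx
        rw [neg_neg]
        exact mul_nonpos_of_nonneg_of_nonpos (h.g_nonneg hx0) (h.F_nonpos ⟨hx0, hxa.le⟩)
    · have := hVγ T A.T_pos.le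
      rw [A.finish, hV0] at this
      exact abs_le_of_sq_le_sq' (by nlinarith) (hε.le.trans hεU) |>.2
  choose γ T q hq hγ hVγ A using key
  have hmono : ∀ u (hu : u ∈ Icc ε U) w (hw : w ∈ Icc ε U), u ≤ w → q u hu ≤ q w hw := by
    intro u hu w hw huw
    rcases huw.eq_or_lt with rfl | huw
    · rfl
    · exact ((A u hu).finish_lt_finish h (A w hw) huw).le
  obtain ⟨p, hp, hfix⟩ : ∃ p, ∃ hp : p ∈ Icc ε U, q p hp = p := by
    set S := {s | ∃ hs : s ∈ Icc ε U, s ≤ q s hs} with hS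
    have hεS : ε ∈ S := ⟨left_mem_Icc.2 hεU, (hq ε _).1⟩
    have hlub : IsLUB S (sSup S) := isLUB_csSup ⟨ε, hεS⟩ ⟨U, fun s hs => hs.1.2⟩
    have hp : sSup S ∈ Icc ε U := ⟨hlub.1 hεS, hlub.2 fun s hs => hs.1.2⟩
    have hle : sSup S ≤ q _ hp :=
      hlub.2 fun s hs => hs.2.trans (hmono s hs.1 _ hp (hlub.1 hs))
    exact ⟨_, hp, le_antisymm (hlub.1 ⟨hq _ hp, hmono _ hp _ (hq _ hp) hle⟩) hle⟩
  have A := A p hp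
  have hγ := hγ p hp
  have hVγ := hVγ p hp
  generalize γ p hp = γ at *
  generalize T p hp = T at *
  rw [hfix] at A
  have hanti : ∀ t, γ (t + T) = -γ t := by
    refine congrFun (eq_of_hasDerivAt_of_contDiff hvd (f := fun t => γ (t + T))
      (g := fun t => -γ t) (t₀ := 0) (fun t => (hγ (t + T)).comp_add_const t T) (fun t => ?_) ?_)
    · rw [hvneg]
      exact (hγ t).fun_neg
    · simp [A.start, A.finish]
  have hper : Function.Periodic γ (2 * T) := fun t => by
    rw [two_mul, ← add_assoc, hanti, hanti, neg_neg]
  refine ⟨γ, T, p, fun t => ?_, A, hanti⟩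
  rw [← hveq]
  · exact hγ t
  · obtain ⟨n, hn⟩ := exists_nat_ge (-t / (2 * T))
    rw [div_le_iff₀ (by linarith [A.T_pos])] at hn
    rw [← hper.nat_mul n t]
    exact hVγ _ (by linarith)

namespace IsLienard

lemma g_eq_zero_iff (h : IsLienard F g G a) {x : ℝ} : g x = 0 ↔ x = 0 := by
  refine ⟨fun hx => ?_, fun hx => hx ▸ h.g_zero⟩
  by_contra hne
  rcases lt_or_gt_of_ne hne with hlt | hgt
  · have := h.g_pos (-x) (neg_pos.2 hlt)
    rw [h.g_neg, hx, neg_zero] at this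
    exact lt_irrefl _ this
  · exact (h.g_pos x hgt).ne' hx

lemma hasDerivAt_neg (h : IsLienard F g G a) {γ : ℝ → ℝ × ℝ} {t : ℝ}
    (hγ : HasDerivAt γ (lienardField F g (γ t)) t) :
    HasDerivAt (fun s => -γ s) (lienardField F g (-γ t)) t := by
  rw [h.field_neg]
  exact hγ.fun_neg

/-- A periodic orbit crossing the `u`-axis in `(0, p)` and, apart from that, only at heights of
modulus at most `p`, contains up to symmetry an arc from `(0, p)` to `(0, -p)`. -/
lemma exists_closed_arc_of_extremal (h : IsLienard F g G a) {γ : ℝ → ℝ × ℝ} {P p : ℝ}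
    (hγ : ∀ t, HasDerivAt γ (lienardField F g (γ t)) t) (hP : 0 < P)
    (hper : Function.Periodic γ P) (hne : ∀ t, γ t ≠ 0) (hp : 0 < p) (h0 : γ 0 = (0, p))
    (hmax : ∀ t, (γ t).1 = 0 → |(γ t).2| ≤ p) :
    ∃ (δ : ℝ → ℝ × ℝ) (T : ℝ), IsLienardArc F g δ T p p ∧ (0, -p) ∈ range γ := by
  have hxc : Continuous fun t => (γ t).1 :=
    continuous_iff_continuousAt.2 fun t => (hγ t).lienard_fst.continuousAt
  have hd0 := (hγ 0).lienard_fst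
  simp only [h0, h.F_zero, sub_zero] at hd0
  have hev := (hd0.eventually_lt_of_pos hp).2
  simp only [h0] at hev
  obtain ⟨c, hc, hcneg⟩ := mem_nhdsLT_iff_exists_Ioo_subset.1 hev
  have hc : c < 0 := hc
  have hPc : -P ≤ c := by
    by_contra! hlt
    have h1 : (γ (-P)).1 < 0 := hcneg ⟨hlt, neg_neg_of_pos hP⟩
    have h2 := hper (-P)
    rw [neg_add_cancel, h0] at h2
    rw [← h2] at h1
    exact lt_irrefl _ h1
  have hcomp : IsCompact (Icc (-P) c ∩ (fun t => (γ t).1) ⁻¹' {0}) :=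
    isCompact_Icc.inter_right (isClosed_singleton.preimage hxc)
  obtain ⟨t₀, ⟨ht₀, hx₀⟩, htmax⟩ := hcomp.exists_isGreatest ⟨-P, left_mem_Icc.2 hPc, by
    have h2 := hper (-P)
    rw [neg_add_cancel, h0] at h2
    simp [← h2]⟩
  have hx₀ : (γ t₀).1 = 0 := hx₀
  have ht₀0 : t₀ < 0 := ht₀.2.trans_lt hc
  have hxneg : ∀ t ∈ Ioo t₀ 0, (γ t).1 < 0 := by
    intro t ht
    rcases lt_or_ge c t with hct | hct
    · exact hcneg ⟨hct, ht.2⟩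
    by_contra! hge
    have hc2 : (γ (c / 2)).1 < 0 := hcneg ⟨by linarith, by linarith⟩
    obtain ⟨s, hs, hs0⟩ := intermediate_value_Icc' (show t ≤ c / 2 by linarith)
      hxc.continuousOn ⟨hc2.le, hge⟩
    simp only at hs0
    rcases lt_or_ge c s with hcs | hcs
    · have : (γ s).1 < 0 := hcneg ⟨hcs, hs.2.trans_lt (by linarith)⟩
      exact this.ne hs0
    · have : s ≤ t₀ := htmax ⟨⟨ht₀.1.trans (ht.1.le.trans hs.1), hcs⟩, hs0⟩
      linarith [ht.1, hs.1]
  have hu₀ : (γ t₀).2 < 0 := by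
    refine lt_of_le_of_ne ?_ fun hu => hne t₀ (Prod.ext hx₀ hu)
    by_contra! hu
    have hd := (hγ t₀).lienard_fst
    rw [hx₀, h.F_zero, sub_zero] at hd
    obtain ⟨s, hs1, hs2⟩ :=
      ((hd.eventually_lt_of_pos hu).1.and (Ioo_mem_nhdsGT ht₀0)).exists
    rw [hx₀] at hs1
    exact (hxneg s hs2).not_gt hs1
  have A : IsLienardArc F g (fun s => -γ (s + t₀)) (-t₀) (-(γ t₀).2) p := by
    refine ⟨neg_pos.2 ht₀0, neg_pos.2 hu₀, hp, fun t _ => ?_, ?_, ?_, fun t ht => ?_⟩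
    · exact h.hasDerivAt_neg ((hγ (t + t₀)).comp_add_const t t₀)
    · rw [zero_add]
      exact Prod.ext (by simp [hx₀]) rfl
    · simp [h0]
    · exact neg_pos.2 (hxneg _ ⟨by linarith [ht.1], by linarith [ht.2]⟩)
  obtain ⟨T, q, -, B⟩ := h.exists_arc_of_return hP (fun t _ => hγ t) hp h0 (by
    have := hper 0
    rw [zero_add] at this
    simp [this, h0])
  have hq : q ≤ p := by
    have := hmax T (by simp [B.finish])
    rwa [B.finish, abs_neg, abs_of_pos B.q_pos] at this
  have hle : -(γ t₀).2 ≤ p := by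
    have := hmax t₀ hx₀
    rwa [abs_of_neg hu₀] at this
  have heq : -(γ t₀).2 = p := by
    refine hle.antisymm (not_lt.1 fun hlt => ?_)
    exact (A.finish_lt_finish h B hlt).not_ge hq
  rw [heq] at A
  exact ⟨_, _, A, t₀, Prod.ext hx₀ (neg_eq_iff_eq_neg.1 heq)⟩

/-- The range of a nonconstant periodic orbit passes through the starting point of an arc from
`(0, p)` to `(0, -p)`. -/
lemma exists_closed_arc (h : IsLienard F g G a) {γ : ℝ → ℝ × ℝ} {P : ℝ}
    (hγ : ∀ t, HasDerivAt γ (lienardField F g (γ t)) t) (hP : 0 < P)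
    (hper : Function.Periodic γ P) (hnc : ¬ ∀ t s, γ t = γ s) :
    ∃ (δ : ℝ → ℝ × ℝ) (T p : ℝ), IsLienardArc F g δ T p p ∧ (0, p) ∈ range γ := by
  have hne : ∀ t, γ t ≠ 0 := by
    intro t ht
    have hz : ∀ s, γ s = 0 := fun s =>
      h.eq_zero_of_eq_zero (fun r (_ : r ∈ Icc (min t s) (max t s)) => hγ r)
        ⟨min_le_left _ _, le_max_left _ _⟩ ht s ⟨min_le_right _ _, le_max_right _ _⟩
    exact hnc fun s r => (hz s).trans (hz r).symm
  have hc : Continuous γ := continuous_iff_continuousAt.2 fun t => (hγ t).continuousAt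
  obtain ⟨z, hz, hz0⟩ := exists_hasDerivAt_eq_zero hP
    (continuous_snd.comp hc).continuousOn
    (by simpa using congrArg Prod.snd (hper 0).symm) fun t _ => (hγ t).lienard_snd
  rw [neg_eq_zero, h.g_eq_zero_iff] at hz0
  have hcomp : IsCompact (Icc 0 P ∩ (fun t => (γ t).1) ⁻¹' {0}) :=
    isCompact_Icc.inter_right (isClosed_singleton.preimage (continuous_fst.comp hc))
  obtain ⟨m, ⟨-, hm0⟩, hmmax⟩ := hcomp.exists_isMaxOn ⟨z, Ioo_subset_Icc_self hz, hz0⟩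
    (f := fun t => |(γ t).2|) (continuous_snd.comp hc).abs.continuousOn
  have hm0 : (γ m).1 = 0 := hm0
  have hmax : ∀ t, (γ t).1 = 0 → |(γ t).2| ≤ |(γ m).2| := by
    intro t ht
    obtain ⟨s, hs, hst⟩ := hper.exists_mem_Ico₀ hP t
    rw [hst]
    refine hmmax ⟨Ico_subset_Icc_self hs, ?_⟩
    simp [← hst, ht]
  have hshift : ∀ t, HasDerivAt (fun s => γ (s + m)) (lienardField F g (γ (t + m))) t :=
    fun t => (hγ (t + m)).comp_add_const t m
  have hum : (γ m).2 ≠ 0 := fun hu => hne m (Prod.ext hm0 hu)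
  rcases lt_or_gt_of_ne hum with hlt | hgt
  · obtain ⟨δ, T, A, t, ht⟩ := h.exists_closed_arc_of_extremal (p := -(γ m).2)
      (fun t => h.hasDerivAt_neg (hshift t)) hP
      (fun t => by rw [add_right_comm, hper]) (fun t => neg_ne_zero.2 (hne _)) (neg_pos.2 hlt)
      (Prod.ext (by simp [hm0]) (by simp)) (fun t ht => by
        simpa [abs_of_neg hlt] using hmax (t + m) (by simpa using ht))
    refine ⟨δ, T, _, A, t + m, ?_⟩
    have ht : -γ (t + m) = _ := ht
    rw [← neg_neg (γ (t + m)), ht]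
    simp
  · obtain ⟨δ, T, A, -⟩ := h.exists_closed_arc_of_extremal (p := (γ m).2) hshift hP
      (fun t => by rw [add_right_comm, hper]) (fun t => hne _) hgt
      (Prod.ext (by simp [hm0]) (by simp)) (fun t ht => by
        simpa [abs_of_pos hgt] using hmax (t + m) ht)
    exact ⟨δ, T, _, A, m, Prod.ext hm0 rfl⟩

/-- Uniqueness of the limit cycle in Liénard's theorem. -/
lemma range_eq_range (h : IsLienard F g G a) {γ₁ γ₂ : ℝ → ℝ × ℝ} {P₁ P₂ : ℝ}
    (hγ₁ : ∀ t, HasDerivAt γ₁ (lienardField F g (γ₁ t)) t) (hP₁ : 0 < P₁)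
    (hper₁ : Function.Periodic γ₁ P₁) (hnc₁ : ¬ ∀ t s, γ₁ t = γ₁ s)
    (hγ₂ : ∀ t, HasDerivAt γ₂ (lienardField F g (γ₂ t)) t) (hP₂ : 0 < P₂)
    (hper₂ : Function.Periodic γ₂ P₂) (hnc₂ : ¬ ∀ t s, γ₂ t = γ₂ s) : range γ₁ = range γ₂ := by
  obtain ⟨δ₁, T₁, p₁, A₁, t₁, ht₁⟩ := h.exists_closed_arc hγ₁ hP₁ hper₁ hnc₁
  obtain ⟨δ₂, T₂, p₂, A₂, t₂, ht₂⟩ := h.exists_closed_arc hγ₂ hP₂ hper₂ hnc₂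
  have hp : p₁ = p₂ := le_antisymm (not_lt.1 (A₂.not_lt_of_closed h A₁))
    (not_lt.1 (A₁.not_lt_of_closed h A₂))
  have heq : (fun t => γ₁ (t + t₁)) = fun t => γ₂ (t + t₂) :=
    eq_of_hasDerivAt_of_contDiff h.contDiff_field (t₀ := 0)
      (fun t => (hγ₁ (t + t₁)).comp_add_const t t₁) (fun t => (hγ₂ (t + t₂)).comp_add_const t t₂)
      (by simp [ht₁, ht₂, hp])
  rw [← (add_right_surjective t₁).range_comp γ₁, ← (add_right_surjective t₂).range_comp γ₂]
  exact congrArg range heq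

end IsLienard

end Lienard

section Quintic

/-- The damping primitive `μ₃ x + b x³ / 3`. -/
noncomputable def dampingPrimitive (μ3 b x : ℝ) : ℝ := μ3 * x + b * x ^ 3 / 3

/-- The quintic restoring force. -/
noncomputable def quinticForce (μ1 μ2 x : ℝ) : ℝ := μ1 * x + μ2 * x ^ 3 + x ^ 5

/-- The potential of the quintic restoring force. -/
noncomputable def quinticPotential (μ1 μ2 x : ℝ) : ℝ := μ1 * x ^ 2 / 2 + μ2 * x ^ 4 / 4 + x ^ 6 / 6

variable {μ1 μ2 μ3 b : ℝ}

lemma hasDerivAt_dampingPrimitive (μ3 b x : ℝ) :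
    HasDerivAt (dampingPrimitive μ3 b) (μ3 + b * x ^ 2) x := by
  refine (((hasDerivAt_id x).const_mul μ3).add
    ((((hasDerivAt_id x).pow 3).const_mul b).div_const 3)).congr_deriv ?_
  simp only [id]
  push_cast
  ring

lemma hasDerivAt_quinticPotential (μ1 μ2 x : ℝ) :
    HasDerivAt (quinticPotential μ1 μ2) (quinticForce μ1 μ2 x) x := by
  refine ((((((hasDerivAt_id x).pow 2).const_mul μ1).div_const 2).add
    ((((hasDerivAt_id x).pow 4).const_mul μ2).div_const 4)).add
    (((hasDerivAt_id x).pow 6).div_const 6)).congr_deriv ?_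
  simp only [id, quinticForce]
  push_cast
  ring

lemma isLienard_quintic (hG : (μ2 ^ 2 - 4 * μ1 < 0 ∧ μ2 < 0) ∨ (0 ≤ μ1 ∧ 0 ≤ μ2))
    (hμ3 : μ3 < 0) (hb : 0 < b) :
    ∃ a, IsLienard (dampingPrimitive μ3 b) (quinticForce μ1 μ2) (quinticPotential μ1 μ2) a := by
  obtain ⟨a, ha, hab⟩ : ∃ a : ℝ, 0 < a ∧ μ3 = -(b * a ^ 2 / 3) := by
    have hpos : 0 < -3 * μ3 / b := div_pos (by linarith) hb
    refine ⟨√(-3 * μ3 / b), Real.sqrt_pos.2 hpos, ?_⟩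
    rw [Real.sq_sqrt hpos.le]
    field_simp
  have hF : ∀ x, dampingPrimitive μ3 b x = b / 3 * (x * (x ^ 2 - a ^ 2)) := fun x => by
    rw [dampingPrimitive, hab]
    ring
  refine ⟨a, ?_, ?_, hasDerivAt_quinticPotential μ1 μ2, ?_, fun x => ?_, fun x => ?_,
    fun x hx => ?_, ha, fun x hx => ?_, ?_, fun x hx y hy hxy => ?_⟩
  · unfold dampingPrimitive
    fun_prop
  · unfold quinticForce
    fun_prop
  · simp [quinticPotential]
  · simp only [dampingPrimitive]
    ring
  · simp only [quinticForce]
    ring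
  · have hq : 0 < μ1 + μ2 * x ^ 2 + (x ^ 2) ^ 2 := by
      rcases hG with ⟨h1, -⟩ | ⟨h1, h2⟩
      · nlinarith [sq_nonneg (2 * x ^ 2 + μ2)]
      · positivity
    have : quinticForce μ1 μ2 x = x * (μ1 + μ2 * x ^ 2 + (x ^ 2) ^ 2) := by
      rw [quinticForce]
      ring
    rw [this]
    exact mul_pos hx hq
  · rw [hF]
    exact mul_neg_of_pos_of_neg (by positivity) (mul_neg_of_pos_of_neg hx.1
      (sub_neg.2 (pow_lt_pow_left₀ hx.2 hx.1.le two_ne_zero)))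
  · rw [hF, sub_self, mul_zero, mul_zero]
  · rw [hF, hF]
    have hx0 : 0 < x := ha.trans_le hx
    have h1 : a ^ 2 ≤ x ^ 2 := pow_le_pow_left₀ ha.le hx 2
    have h2 : x ^ 2 < y ^ 2 := pow_lt_pow_left₀ hxy hx0.le two_ne_zero
    exact mul_lt_mul_of_pos_left
      (mul_lt_mul'' hxy (by linarith) hx0.le (sub_nonneg.2 h1)) (by positivity)

lemma exists_bound_on_Icc {f : ℝ → ℝ} (hf : Continuous f) (K : ℝ) :
    ∃ C, 0 ≤ C ∧ ∀ x, |x| ≤ K → |f x| ≤ C := by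
  obtain ⟨C, hC⟩ := isCompact_Icc.exists_bound_of_continuousOn (s := Icc (-K) K) hf.continuousOn
  exact ⟨max C 0, le_max_right _ _, fun x hx => (hC x (abs_le.1 hx)).trans (le_max_left _ _)⟩

/-- A function on the Liénard plane which decreases along orbits far away from the origin. -/
noncomputable def quinticLyapunov (μ1 μ2 : ℝ) (p : ℝ × ℝ) : ℝ :=
  (p.2 - p.1) ^ 2 / 2 + quinticPotential μ1 μ2 p.1

lemma continuous_quinticPotential : Continuous (quinticPotential μ1 μ2) := by
  unfold quinticPotential
  fun_prop

lemma exists_sq_sub_le_quinticPotential (μ1 μ2 : ℝ) :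
    ∃ L, ∀ x, x ^ 2 - L ≤ quinticPotential μ1 μ2 x := by
  set K := 6 * (1 + |μ1| + |μ2|) with hK
  obtain ⟨C, hC0, hC⟩ := exists_bound_on_Icc (continuous_quinticPotential (μ1 := μ1) (μ2 := μ2)) K
  have hK1 : 1 ≤ K := by linarith [abs_nonneg μ1, abs_nonneg μ2]
  refine ⟨C + K ^ 2, fun x => ?_⟩
  rcases le_total |x| K with hx | hx
  · have h1 := (abs_le.1 (hC x hx)).1
    have h2 : x ^ 2 ≤ K ^ 2 := sq_le_sq.2 (hx.trans (le_abs_self K))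
    linarith
  · have hX : K ≤ x ^ 2 := by
      rw [← sq_abs]
      nlinarith
    have h1 := neg_abs_le μ1
    have h2 := neg_abs_le μ2
    have h3 : quinticPotential μ1 μ2 x =
        x ^ 2 * (μ1 / 2 + μ2 / 4 * x ^ 2 + x ^ 2 * x ^ 2 / 6) := by
      rw [quinticPotential]
      ring
    have h4 : 1 ≤ μ1 / 2 + μ2 / 4 * x ^ 2 + x ^ 2 * x ^ 2 / 6 := by
      nlinarith [abs_nonneg μ1, abs_nonneg μ2, sq_nonneg x,
        mul_le_mul_of_nonneg_right hX (sq_nonneg x),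
        mul_le_mul_of_nonneg_right h2 (sq_nonneg x),
        mul_nonneg (abs_nonneg μ2) (sq_nonneg x), mul_nonneg (abs_nonneg μ1) (sq_nonneg x)]
    rw [h3]
    nlinarith [sq_nonneg x, mul_le_mul_of_nonneg_left h4 (sq_nonneg x)]

lemma isBounded_quinticLyapunov_le (μ1 μ2 c : ℝ) :
    Bornology.IsBounded {p | quinticLyapunov μ1 μ2 p ≤ c} := by
  obtain ⟨L, hL⟩ := exists_sq_sub_le_quinticPotential μ1 μ2
  refine isBounded_iff_forall_norm_le.2 ⟨2 + 2 * (c + L), fun p hp => ?_⟩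
  have h1 := hL p.1
  have hp : (p.2 - p.1) ^ 2 / 2 + quinticPotential μ1 μ2 p.1 ≤ c := hp
  refine max_le (abs_le.2 ⟨?_, ?_⟩) (abs_le.2 ⟨?_, ?_⟩) <;>
    nlinarith [sq_nonneg (p.1 + 1), sq_nonneg (p.1 - 1), sq_nonneg (p.2 - p.1 + 1),
      sq_nonneg (p.2 - p.1 - 1)]

lemma hasFDerivAt_quinticLyapunov (μ1 μ2 : ℝ) (p : ℝ × ℝ) :
    HasFDerivAt (quinticLyapunov μ1 μ2)
      ((p.2 - p.1) • (ContinuousLinearMap.snd ℝ ℝ ℝ - ContinuousLinearMap.fst ℝ ℝ ℝ) +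
        quinticForce μ1 μ2 p.1 • ContinuousLinearMap.fst ℝ ℝ ℝ) p := by
  have h1 : HasFDerivAt (fun p : ℝ × ℝ => p.2 - p.1)
      (ContinuousLinearMap.snd ℝ ℝ ℝ - ContinuousLinearMap.fst ℝ ℝ ℝ) p :=
    hasFDerivAt_snd.sub hasFDerivAt_fst
  have h2 : HasDerivAt (fun s : ℝ => s ^ 2 / 2) (p.2 - p.1) (p.2 - p.1) := by
    refine (((hasDerivAt_id (p.2 - p.1)).pow 2).div_const 2).congr_deriv ?_
    simp
  exact (h2.comp_hasFDerivAt p h1).add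
    ((hasDerivAt_quinticPotential μ1 μ2 p.1).comp_hasFDerivAt p hasFDerivAt_fst)

lemma exists_fderiv_quinticLyapunov_nonpos (hμ3 : μ3 < 0) (hb : 0 < b) :
    ∃ c₀, ∀ p, c₀ < quinticLyapunov μ1 μ2 p →
      fderiv ℝ (quinticLyapunov μ1 μ2) p
        (lienardField (dampingPrimitive μ3 b) (quinticForce μ1 μ2) p) ≤ 0 := by
  set K := 1 + |μ1| + |μ2| + b + 3 * (1 - μ3) / b with hK
  have hKb : 0 < 3 * (1 - μ3) / b := div_pos (by linarith) hb
  have hμ1 := abs_nonneg μ1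
  have hμ2 := abs_nonneg μ2
  obtain ⟨C, hC0, hC⟩ := exists_bound_on_Icc (f := fun x => quinticForce μ1 μ2 x *
    (x - dampingPrimitive μ3 b x) + (x - dampingPrimitive μ3 b x) ^ 2 / 2)
    (by unfold quinticForce dampingPrimitive; fun_prop) K
  obtain ⟨C', hC'0, hC'⟩ :=
    exists_bound_on_Icc (continuous_quinticPotential (μ1 := μ1) (μ2 := μ2)) K
  refine ⟨C + C', fun ⟨x, u⟩ hp => ?_⟩
  rw [(hasFDerivAt_quinticLyapunov μ1 μ2 (x, u)).fderiv]
  simp only [quinticLyapunov] at hp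
  simp only [lienardField, add_apply, smul_apply,
    sub_apply, ContinuousLinearMap.coe_fst', ContinuousLinearMap.coe_snd',
    smul_eq_mul]
  rcases le_total |x| K with hx | hx
  · have h1 := (abs_le.1 (hC x hx)).2
    have h2 := (abs_le.1 (hC' x hx)).2
    nlinarith [sq_nonneg (u - x + (x - dampingPrimitive μ3 b x))]
  · have hX : K ≤ x ^ 2 := by
      rw [← sq_abs]
      nlinarith
    have he : 0 ≤ b * x ^ 2 / 3 - (1 - μ3) := by
      have : 3 * (1 - μ3) / b ≤ x ^ 2 := by linarith
      rw [div_le_iff₀ hb] at this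
      linarith
    have hq : 0 ≤ μ1 + μ2 * x ^ 2 + x ^ 2 * x ^ 2 - (b * x ^ 2 / 3 - (1 - μ3)) / 4 := by
      have h1 := neg_abs_le μ1
      have h2 := mul_le_mul_of_nonneg_right (neg_abs_le μ2) (sq_nonneg x)
      have h3 := mul_le_mul_of_nonneg_right hX (sq_nonneg x)
      have h4 : 1 ≤ x ^ 2 := by linarith
      have h5 := mul_le_mul_of_nonneg_left h4 hμ1
      have h6 := mul_nonneg hKb.le (sq_nonneg x)
      have h7 := mul_nonneg hb.le (sq_nonneg x)
      rw [hK] at h3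
      nlinarith
    have h1 := mul_nonneg (sq_nonneg x) (mul_nonneg he hq)
    have h2 : quinticForce μ1 μ2 x * (x - dampingPrimitive μ3 b x) +
        (x - dampingPrimitive μ3 b x) ^ 2 / 4 = -(x ^ 2 * ((b * x ^ 2 / 3 - (1 - μ3)) *
          (μ1 + μ2 * x ^ 2 + x ^ 2 * x ^ 2 - (b * x ^ 2 / 3 - (1 - μ3)) / 4))) := by
      simp only [quinticForce, dampingPrimitive]
      ring
    nlinarith [sq_nonneg (u - x + (x - dampingPrimitive μ3 b x) / 2)]

/-- System (I) is a Liénard system in the coordinates `(x, y + F x)`. -/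
lemma IsSolI.lienard {γ : ℝ → ℝ × ℝ} (hγ : IsSolI μ1 μ2 μ3 b γ) (t : ℝ) :
    HasDerivAt (fun s => ((γ s).1, (γ s).2 + dampingPrimitive μ3 b (γ s).1))
      (lienardField (dampingPrimitive μ3 b) (quinticForce μ1 μ2)
        ((γ t).1, (γ t).2 + dampingPrimitive μ3 b (γ t).1)) t := by
  have h1 : HasDerivAt (fun s => (γ s).1) _ t :=
    (hasFDerivAt_fst (𝕜 := ℝ) (p := γ t)).comp_hasDerivAt t (hγ t)
  have h2 : HasDerivAt (fun s => (γ s).2) _ t :=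
    (hasFDerivAt_snd (𝕜 := ℝ) (p := γ t)).comp_hasDerivAt t (hγ t)
  refine (h1.prodMk (h2.add ((hasDerivAt_dampingPrimitive μ3 b _).comp t h1))).congr_deriv ?_
  simp only [lienardField, quinticForce, ContinuousLinearMap.coe_fst',
    ContinuousLinearMap.coe_snd']
  exact Prod.ext (by simp) (by ring)

/-- Solutions in the Liénard plane give solutions of system (I). -/
lemma isSolI_of_lienard {γ : ℝ → ℝ × ℝ}
    (hγ : ∀ t, HasDerivAt γ (lienardField (dampingPrimitive μ3 b) (quinticForce μ1 μ2) (γ t)) t) :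
    IsSolI μ1 μ2 μ3 b fun t => ((γ t).1, (γ t).2 - dampingPrimitive μ3 b (γ t).1) := by
  intro t
  refine ((hγ t).lienard_fst.prodMk ((hγ t).lienard_snd.sub
    ((hasDerivAt_dampingPrimitive μ3 b _).comp t (hγ t).lienard_fst))).congr_deriv ?_
  simp only [quinticForce]

lemma exists_isNonconstPeriodicSolI
    (hG : (μ2 ^ 2 - 4 * μ1 < 0 ∧ μ2 < 0) ∨ (0 ≤ μ1 ∧ 0 ≤ μ2)) (hμ3 : μ3 < 0) (hb : 0 < b) :
    ∃ γ, IsNonconstPeriodicSolI μ1 μ2 μ3 b γ := by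
  obtain ⟨a, h⟩ := isLienard_quintic hG hμ3 hb
  obtain ⟨c₀, hc₀⟩ := exists_fderiv_quinticLyapunov_nonpos (μ1 := μ1) (μ2 := μ2) hμ3 hb
  obtain ⟨γ, T, p, hγ, A, hanti⟩ := h.exists_antiperiodic
    (fun p => (hasFDerivAt_quinticLyapunov μ1 μ2 p).differentiableAt)
    (isBounded_quinticLyapunov_le μ1 μ2) (fun u => by simp [quinticLyapunov, quinticPotential]) hc₀
  refine ⟨_, isSolI_of_lienard hγ, ⟨2 * T, by linarith [A.T_pos], fun t => ?_⟩, fun hcon => ?_⟩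
  · have : γ (t + 2 * T) = γ t := by
      rw [two_mul, ← add_assoc, hanti, hanti, neg_neg]
    simp only [this]
  · have := congrArg Prod.snd (hcon 0 T)
    simp only [A.start, A.finish] at this
    linarith [A.p_pos]

lemma IsNonconstPeriodicSolI.range_eq_range {γ1 γ2 : ℝ → ℝ × ℝ}
    (hG : (μ2 ^ 2 - 4 * μ1 < 0 ∧ μ2 < 0) ∨ (0 ≤ μ1 ∧ 0 ≤ μ2)) (hμ3 : μ3 < 0) (hb : 0 < b)
    (h1 : IsNonconstPeriodicSolI μ1 μ2 μ3 b γ1) (h2 : IsNonconstPeriodicSolI μ1 μ2 μ3 b γ2) :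
    range γ1 = range γ2 := by
  obtain ⟨a, h⟩ := isLienard_quintic hG hμ3 hb
  set Φ : ℝ × ℝ → ℝ × ℝ := fun p => (p.1, p.2 + dampingPrimitive μ3 b p.1) with hΦ
  have hinj : Function.Injective Φ := by
    rintro ⟨x, y⟩ ⟨x', y'⟩ hxy
    obtain ⟨rfl, hy⟩ := Prod.mk.inj hxy
    exact Prod.ext rfl (add_right_cancel hy)
  obtain ⟨hs1, ⟨P1, hP1, hper1⟩, hnc1⟩ := h1
  obtain ⟨hs2, ⟨P2, hP2, hper2⟩, hnc2⟩ := h2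
  have := h.range_eq_range (γ₁ := Φ ∘ γ1) (γ₂ := Φ ∘ γ2) hs1.lienard hP1
    (fun t => congrArg Φ (hper1 t)) (fun hcon => hnc1 fun t s => hinj (hcon t s)) hs2.lienard hP2
    (fun t => congrArg Φ (hper2 t)) fun hcon => hnc2 fun t s => hinj (hcon t s)
  rw [range_comp, range_comp] at this
  exact hinj.image_injective this

end Quintic

end LienardTheorem

/-- in the parameter region 𝒢₁ with μ3 < 0 and b > 0, system (I) has a
nonconstant periodic solution, and any two nonconstant periodic solutions have the same
image (a unique limit cycle). -/
theorem stmt2 (μ1 μ2 μ3 b : ℝ)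
    (hG : (μ2 ^ 2 - 4 * μ1 < 0 ∧ μ2 < 0) ∨ (0 ≤ μ1 ∧ 0 ≤ μ2))
    (hμ3 : μ3 < 0) (hb : 0 < b) :
    (∃ γ : ℝ → ℝ × ℝ, IsNonconstPeriodicSolI μ1 μ2 μ3 b γ) ∧
    (∀ γ1 γ2 : ℝ → ℝ × ℝ, IsNonconstPeriodicSolI μ1 μ2 μ3 b γ1 →
      IsNonconstPeriodicSolI μ1 μ2 μ3 b γ2 → Set.range γ1 = Set.range γ2) := by
  exact ⟨exists_isNonconstPeriodicSolI hG hμ3 hb,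
    fun _ _ h1 h2 => h1.range_eq_range hG hμ3 hb h2⟩
end

section
/- Let μ1 > 0, μ2 < −2·√μ1, let μ3, b ∈ ℝ, set Δ = μ2² − 4·μ1 and x0 = √((−μ2 − √Δ)/2). Then the characteristic polynomial of the Jacobian matrix of system (I) at the equilibrium (x0, 0), namely λ² + (μ3 + b·x0²)·λ + (μ1 + 3·μ2·x0² + 5·x0⁴), has two real roots λ1, λ2 with λ1 < 0 < λ2. (Hence the equilibria E_{r1} and E_{l1} are saddles.) -/
/-- A monic real quadratic with negative constant term has exactly two real roots,
of opposite signs. -/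
theorem exists_neg_pos_roots_of_const_neg (p q : ℝ) (hq : q < 0) :
    ∃ l1 l2 : ℝ, l1 < 0 ∧ 0 < l2 ∧ ∀ l : ℝ, l ^ 2 + p * l + q = 0 ↔ (l = l1 ∨ l = l2) := by
  have hd : Real.sqrt (p ^ 2 - 4 * q) ^ 2 = p ^ 2 - 4 * q :=
    Real.sq_sqrt (by nlinarith [sq_nonneg p])
  have habs : |p| < Real.sqrt (p ^ 2 - 4 * q) :=
    Real.lt_sqrt_of_sq_lt (by rw [sq_abs]; linarith)
  obtain ⟨hl, hr⟩ := abs_lt.mp habs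
  set r := Real.sqrt (p ^ 2 - 4 * q)
  refine ⟨(-p - r) / 2, (-p + r) / 2, by linarith, by linarith, fun l => ?_⟩
  have hfac : l ^ 2 + p * l + q = (l - (-p - r) / 2) * (l - (-p + r) / 2) := by
    linear_combination hd / 4
  rw [hfac, mul_eq_zero, sub_eq_zero, sub_eq_zero]

/-- for μ1 > 0, μ2 < −2√μ1, with Δ = μ2² − 4μ1 and
x0 = √((−μ2 − √Δ)/2), the characteristic polynomial
λ² + (μ3 + b x0²) λ + (μ1 + 3 μ2 x0² + 5 x0⁴) of the Jacobian at (x0, 0)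
has exactly two real roots λ1 < 0 < λ2 (E_{r1}, E_{l1} are saddles). -/
theorem stmt4 (μ1 μ2 μ3 b : ℝ) (h1 : 0 < μ1) (h2 : μ2 < -2 * Real.sqrt μ1) :
    ∃ l1 l2 : ℝ, l1 < 0 ∧ 0 < l2 ∧
      ∀ l : ℝ,
        (l ^ 2
          + (μ3 + b * (Real.sqrt ((-μ2 - Real.sqrt (μ2 ^ 2 - 4 * μ1)) / 2)) ^ 2) * l
          + (μ1 + 3 * μ2 * (Real.sqrt ((-μ2 - Real.sqrt (μ2 ^ 2 - 4 * μ1)) / 2)) ^ 2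
              + 5 * (Real.sqrt ((-μ2 - Real.sqrt (μ2 ^ 2 - 4 * μ1)) / 2)) ^ 4) = 0)
        ↔ (l = l1 ∨ l = l2) := by
  apply exists_neg_pos_roots_of_const_neg
  have hm : Real.sqrt μ1 ^ 2 = μ1 := Real.sq_sqrt h1.le
  have hm0 : 0 < Real.sqrt μ1 := Real.sqrt_pos.mpr h1
  have hΔ : 0 < μ2 ^ 2 - 4 * μ1 := by nlinarith
  have hs : Real.sqrt (μ2 ^ 2 - 4 * μ1) ^ 2 = μ2 ^ 2 - 4 * μ1 := Real.sq_sqrt hΔ.le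
  have hs0 : 0 < Real.sqrt (μ2 ^ 2 - 4 * μ1) := Real.sqrt_pos.mpr hΔ
  set s := Real.sqrt (μ2 ^ 2 - 4 * μ1)
  have hu : 0 < (-μ2 - s) / 2 := by nlinarith
  have hx : Real.sqrt ((-μ2 - s) / 2) ^ 2 = (-μ2 - s) / 2 := Real.sq_sqrt hu.le
  have hx4 : Real.sqrt ((-μ2 - s) / 2) ^ 4 = ((-μ2 - s) / 2) ^ 2 := by
    rw [← hx, ← pow_mul, hx]
  rw [hx, hx4]
  nlinarith [mul_pos hu hs0]
end

section
/- Let a1 ≥ 0, δ > 0 and −1/3 ≤ a2 < 0. Then every periodic solution of system (II) is constant; that is, system (II) has no limit cycles when −1/3 ≤ a2 < 0. -/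
/-- A solution of system (II): x' = y, y' = −x(a1 + x²)(x² − 1) − δ(a2 + x²) y. -/
def IsSolII (a1 a2 δ : ℝ) (γ : ℝ → ℝ × ℝ) : Prop :=
  ∀ t : ℝ, HasDerivAt γ
    ((γ t).2,
      -((γ t).1 * (a1 + (γ t).1 ^ 2) * ((γ t).1 ^ 2 - 1))
        - δ * (a2 + (γ t).1 ^ 2) * (γ t).2) t

open Filter Topology

/-- A periodic antitone function is locally constant. -/
theorem Antitone.eventuallyEq_const_of_periodic {U : ℝ → ℝ} (hU : Antitone U) {T : ℝ} (hT : 0 < T)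
    (hper : Function.Periodic U T) (t : ℝ) : U =ᶠ[𝓝 t] fun _ => U t := by
  filter_upwards [Icc_mem_nhds (by linarith : t - T < t) (by linarith : t < t + T)] with s hs
  have h₁ := hper t
  have h₂ := hper s
  rcases le_total s t with h | h
  · exact le_antisymm (h₂ ▸ hU (by linarith [hs.1] : t ≤ s + T)) (hU h)
  · exact le_antisymm (hU h) (h₁ ▸ hU hs.2)

/-- A Lyapunov function for system (II): the energy `y² / 2 + G(x)` corrected by
`-δ a2 ((x³ - x) y + δ K(x))`, where `K' = (x³ - x) (a2 + x²)`. -/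
noncomputable def lyapunovII (a1 a2 δ : ℝ) (p : ℝ × ℝ) : ℝ :=
  p.2 ^ 2 / 2 + (p.1 ^ 6 / 6 + (a1 - 1) * p.1 ^ 4 / 4 - a1 * p.1 ^ 2 / 2)
    - δ * a2 * ((p.1 ^ 3 - p.1) * p.2
      + δ * (p.1 ^ 6 / 6 + (a2 - 1) * p.1 ^ 4 / 4 - a2 * p.1 ^ 2 / 2))

theorem IsSolII.hasDerivAt_fst {a1 a2 δ : ℝ} {γ : ℝ → ℝ × ℝ} (h : IsSolII a1 a2 δ γ) (t : ℝ) :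
    HasDerivAt (fun t => (γ t).1) (γ t).2 t :=
  (hasFDerivAt_fst (𝕜 := ℝ) (E := ℝ) (F := ℝ) (p := γ t)).comp_hasDerivAt t (h t)

theorem IsSolII.hasDerivAt_snd {a1 a2 δ : ℝ} {γ : ℝ → ℝ × ℝ} (h : IsSolII a1 a2 δ γ) (t : ℝ) :
    HasDerivAt (fun t => (γ t).2)
      (-((γ t).1 * (a1 + (γ t).1 ^ 2) * ((γ t).1 ^ 2 - 1))
        - δ * (a2 + (γ t).1 ^ 2) * (γ t).2) t :=
  (hasFDerivAt_snd (𝕜 := ℝ) (E := ℝ) (F := ℝ) (p := γ t)).comp_hasDerivAt t (h t)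

theorem IsSolII.hasDerivAt_lyapunovII {a1 a2 δ : ℝ} {γ : ℝ → ℝ × ℝ} (h : IsSolII a1 a2 δ γ)
    (t : ℝ) :
    HasDerivAt (fun t => lyapunovII a1 a2 δ (γ t))
      (-(δ * (1 + 3 * a2) * ((γ t).1 * (γ t).2) ^ 2)
        + δ * a2 * ((a1 + (γ t).1 ^ 2) * ((γ t).1 * ((γ t).1 ^ 2 - 1)) ^ 2)) t := by
  have hx := h.hasDerivAt_fst t
  have hy := h.hasDerivAt_snd t
  have hE := ((hy.pow 2).div_const 2).add
    ((((hx.pow 6).div_const 6).add (((hx.pow 4).const_mul (a1 - 1)).div_const 4)).sub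
      (((hx.pow 2).const_mul a1).div_const 2))
  have hK := (((hx.pow 6).div_const 6).add (((hx.pow 4).const_mul (a2 - 1)).div_const 4)).sub
    (((hx.pow 2).const_mul a2).div_const 2)
  refine (hE.sub (((((hx.pow 3).sub hx).mul hy).add (hK.const_mul δ)).const_mul
    (δ * a2))).congr_deriv ?_
  simp only [Pi.sub_apply, Pi.pow_apply]
  ring

/-- for a1 ≥ 0, δ > 0 and −1/3 ≤ a2 < 0, every periodic solution of
system (II) is constant (no limit cycles). -/
theorem stmt6 (a1 a2 δ : ℝ) (ha1 : 0 ≤ a1) (hδ : 0 < δ)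
    (ha2l : -1/3 ≤ a2) (ha2r : a2 < 0)
    (γ : ℝ → ℝ × ℝ) (hsol : IsSolII a1 a2 δ γ)
    (T : ℝ) (hT : 0 < T) (hper : ∀ t : ℝ, γ (t + T) = γ t) :
    ∀ t s : ℝ, γ t = γ s := by
  have hd := hsol.hasDerivAt_lyapunovII
  have hdiss₁ (t : ℝ) : 0 ≤ δ * (1 + 3 * a2) * ((γ t).1 * (γ t).2) ^ 2 := by
    have : 0 ≤ 1 + 3 * a2 := by linarith
    positivity
  have hdiss₂ (t : ℝ) :
      δ * a2 * ((a1 + (γ t).1 ^ 2) * ((γ t).1 * ((γ t).1 ^ 2 - 1)) ^ 2) ≤ 0 :=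
    mul_nonpos_of_nonpos_of_nonneg (mul_neg_of_pos_of_neg hδ ha2r).le (by positivity)
  have hanti : Antitone fun t => lyapunovII a1 a2 δ (γ t) :=
    antitone_of_hasDerivAt_nonpos hd fun t =>
      show _ ≤ (0 : ℝ) by linarith [hdiss₁ t, hdiss₂ t]
  have hx (t : ℝ) : (γ t).1 ^ 3 - (γ t).1 = 0 := by
    have hconst := hanti.eventuallyEq_const_of_periodic hT (fun t => by simp only [hper]) t
    have h0 := (hd t).unique ((hasDerivAt_const t _).congr_of_eventuallyEq hconst)
    have h1 : δ * a2 * ((a1 + (γ t).1 ^ 2) * ((γ t).1 * ((γ t).1 ^ 2 - 1)) ^ 2) = 0 := by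
      linarith [hdiss₁ t, hdiss₂ t]
    rw [mul_eq_zero_iff_left (mul_neg_of_pos_of_neg hδ ha2r).ne] at h1
    rcases mul_eq_zero.1 h1 with h | h
    · have : (γ t).1 = 0 := by
        rw [← sq_eq_zero_iff]
        linarith [sq_nonneg (γ t).1]
      simp [this]
    · linear_combination (pow_eq_zero_iff two_ne_zero).1 h
  have hy (t : ℝ) : (γ t).2 = 0 := by
    have hx' := hsol.hasDerivAt_fst t
    have h0 := ((hx'.pow 3).sub hx').unique
      ((hasDerivAt_const t (0 : ℝ)).congr_of_eventuallyEq (.of_forall hx))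
    -- `(3 x² - 1) y = 0` and `x (x² - 1) = 0` yield `y = 0`.
    have h1 : (3 * (γ t).1 ^ 2 - 1) * (γ t).2 = 0 := by
      linear_combination h0
    linear_combination (3 / 2 * (γ t).1 ^ 2 - 1) * h1 - 9 / 2 * (γ t).1 * (γ t).2 * hx t
  refine is_const_of_deriv_eq_zero (fun t => (hsol t).differentiableAt) fun t => ?_
  rw [(hsol t).deriv, hy t]
  refine Prod.ext rfl ?_
  rw [Prod.snd_zero]
  linear_combination -(a1 + (γ t).1 ^ 2) * hx t
end
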